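/- Let n ≥ 3 and let V be any finite-dimensional ℚ-linear representation of GL_n(ℤ). Then the first group cohomology vanishes: H^1(GL_n(ℤ), V) = 0. -/

import Mathlib

section sl2
attribute [local instance] LieRing.ofAssociativeRing
variable {W : Type} [AddCommGroup W] [Module ℂ W] [FiniteDimensional ℂ W]

theorem sl2_int (H X Y : Module.End ℂ W) (hX : IsNilpotent X) (h1 : ⁅X, Y⁆ = H)
    (h2 : ⁅H, X⁆ = (2 : ℂ) • X) (h3 : ⁅H, Y⁆ = -((2 : ℂ) • Y)) (μ : ℂ) (hμ : H.HasEigenvalue μ) :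
    ∃ k : ℤ, μ = k := by
  by_cases hH : H = 0
  · subst hH
    obtain ⟨v, hv⟩ := hμ.exists_hasEigenvector
    have := hv.apply_eq_smul
    simp only [LinearMap.zero_apply] at this
    exact ⟨0, by simpa [hv.2] using this.symm⟩
  have t : IsSl2Triple H X Y := ⟨hH, h1, by rw [h2]; exact ofNat_smul_eq_nsmul ℂ 2 X, by
    rw [h3]; congr 1; exact ofNat_smul_eq_nsmul ℂ 2 Y⟩
  obtain ⟨v, hv⟩ := hμ.exists_hasEigenvector
  have hchain : ∀ k : ℕ, H ((X ^ k) v) = (μ + 2 * k) • ((X ^ k) v) := by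
    intro k
    induction k with
    | zero => simpa using hv.apply_eq_smul
    | succ k ih =>
      have h4 : H * X = X * H + (2 : ℂ) • X := by
        rw [← h2, Ring.lie_def]; abel
      rw [pow_succ', Module.End.mul_apply, ← Module.End.mul_apply H, h4, LinearMap.add_apply,
        Module.End.mul_apply, ih, map_smul, LinearMap.smul_apply, ← add_smul]
      push_cast; congr 1; ring
  obtain ⟨N, hN⟩ := hX
  have hex : ∃ k, (X ^ k) v = 0 := ⟨N, by rw [hN]; simp⟩
  obtain ⟨k, hk1, hk2⟩ := Nat.exists_not_and_succ_of_not_zero_of_exists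
    (p := fun k => (X ^ k) v = 0) (by simpa using hv.2) hex
  have P : t.HasPrimitiveVectorWith ((X ^ k) v) (μ + 2 * k) :=
    ⟨hk1, hchain k, by
      have : X ((X ^ k) v) = 0 := by rw [← Module.End.mul_apply, ← pow_succ']; exact hk2
      exact this⟩
  obtain ⟨m, hm⟩ := P.exists_nat
  exact ⟨m - 2 * k, by push_cast; rw [← hm]; ring⟩

theorem trace_sq (H : Module.End ℂ W) (hH : ∀ μ, H.HasEigenvalue μ → ∃ k : ℤ, μ = k) :
    ∃ r : ℝ, LinearMap.trace ℂ W (H * H) = r ∧ 0 ≤ r ∧ (r = 0 → IsNilpotent H) := by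
  have hroot : ∀ μ ∈ (H * H).charpoly.roots, ∃ r : ℝ, μ = r ∧ 0 ≤ r := by
    intro μ hμ
    have he : (H * H).HasEigenvalue μ :=
      (Module.End.hasEigenvalue_iff_isRoot_charpoly _ _).2 (Polynomial.isRoot_of_mem_roots hμ)
    obtain ⟨s, hs⟩ := IsAlgClosed.exists_pow_nat_eq μ (n := 2) (by norm_num)
    obtain ⟨v, hv⟩ := he.exists_hasEigenvector
    have h1 : H (H v) = (s ^ 2) • v := by rw [hs]; exact hv.apply_eq_smul
    by_cases h0 : H v - s • v = 0
    · obtain ⟨k, hk⟩ := hH s (Module.End.hasEigenvalue_of_hasEigenvector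
        (x := v) (Module.End.hasEigenvector_iff.2 ⟨Module.End.mem_eigenspace_iff.2 (sub_eq_zero.1 h0), hv.2⟩))
      exact ⟨(k : ℝ) ^ 2, by rw [← hs, hk]; push_cast; rfl, sq_nonneg _⟩
    · obtain ⟨k, hk⟩ := hH (-s) (Module.End.hasEigenvalue_of_hasEigenvector
        (x := H v - s • v) (Module.End.hasEigenvector_iff.2 ⟨Module.End.mem_eigenspace_iff.2 (by
          rw [map_sub, map_smul, h1]; module), h0⟩))
      exact ⟨(k : ℝ) ^ 2, by rw [← hs, ← neg_sq, hk]; push_cast; rfl, sq_nonneg _⟩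
  choose! f hf1 hf2 using hroot
  have hsplit : (H * H).charpoly.Splits := IsAlgClosed.splits _
  refine ⟨((H * H).charpoly.roots.map f).sum, ?_, ?_, ?_⟩
  · rw [Module.End.trace_eq_sum_roots_charpoly_of_splits hsplit]
    have : (H * H).charpoly.roots = ((H * H).charpoly.roots.map f).map (fun x : ℝ => (x : ℂ)) := by
      rw [Multiset.map_map]
      conv_lhs => rw [← Multiset.map_id (H * H).charpoly.roots]
      exact Multiset.map_congr rfl fun x hx => hf1 x hx
    conv_lhs => rw [this]
    exact (map_multiset_sum Complex.ofRealHom _).symm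
  · apply Multiset.sum_nonneg
    intro x hx
    obtain ⟨y, hy, rfl⟩ := Multiset.mem_map.1 hx
    exact hf2 y hy
  · intro h0
    have hz : ∀ μ ∈ (H * H).charpoly.roots, μ = 0 := by
      intro μ hμ
      have hnn : ∀ x ∈ (H * H).charpoly.roots.map f, 0 ≤ x := by
        intro x hx
        obtain ⟨y, hy, rfl⟩ := Multiset.mem_map.1 hx
        exact hf2 y hy
      have h2 := Multiset.single_le_sum hnn _ (Multiset.mem_map_of_mem f hμ)
      rw [h0] at h2
      rw [hf1 μ hμ, le_antisymm h2 (hf2 μ hμ)]; simp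
    have h3 : IsNilpotent (H * H) := by
      rw [LinearMap.isNilpotent_iff_charpoly]
      have hm := (H * H).charpoly_monic
      have hr : (H * H).charpoly.roots =
          Multiset.replicate (Multiset.card (H * H).charpoly.roots) 0 :=
        Multiset.eq_replicate.2 ⟨rfl, hz⟩
      have hp := hsplit.eq_prod_roots_of_monic hm
      rw [hr] at hp
      simp only [Multiset.map_replicate, Multiset.prod_replicate, map_zero, sub_zero] at hp
      have hd := congrArg Polynomial.natDegree hp
      rw [LinearMap.charpoly_natDegree, Polynomial.natDegree_X_pow] at hd
      rw [hd]; exact hp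
    obtain ⟨k, hk⟩ := h3
    exact ⟨2 * k, by rw [pow_mul, sq, hk]⟩

theorem nil_lie (H X : Module.End ℂ W) (hH : IsNilpotent H) (h2 : ⁅H, X⁆ = (2 : ℂ) • X) : X = 0 := by
  obtain ⟨k, hk⟩ := LieAlgebra.ad_nilpotent_of_nilpotent (R := ℂ) hH
  have : ∀ k : ℕ, ((LieAlgebra.ad ℂ (Module.End ℂ W) H) ^ k) X = (2 : ℂ) ^ k • X := by
    intro k
    induction k with
    | zero => simp
    | succ k ih => rw [pow_succ', Module.End.mul_apply, ih, map_smul, LieAlgebra.ad_apply, h2, smul_smul,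
        pow_succ]
  have h := this k
  rw [hk] at h
  simpa using h.symm

theorem gl_vanish {n : ℕ} (hn : 0 < n) (E : Fin n → Fin n → Module.End ℂ W)
    (hE : ∀ i j k l, ⁅E i j, E k l⁆ = (if j = k then E i l else 0) - (if l = i then E k j else 0))
    (hsum : ∑ i, E i i = 0) (hnil : ∀ i j, i ≠ j → IsNilpotent (E i j))
    (hC : IsNilpotent (∑ i, ∑ j, E i j * E j i)) (i j : Fin n) (hij : i ≠ j) : E i j = 0 := by
  set H : Fin n → Fin n → Module.End ℂ W := fun i j => E i i - E j j with hHdef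
  have r1 : ∀ i j, i ≠ j → ⁅E i j, E j i⁆ = H i j := by
    intro i j hij; rw [hE]; simp [hHdef]
  have r2 : ∀ i j, i ≠ j → ⁅H i j, E i j⁆ = (2 : ℂ) • E i j := by
    intro i j hij; simp only [hHdef, sub_lie, hE]; simp [hij, hij.symm, two_smul]
  have r3 : ∀ i j, i ≠ j → ⁅H i j, E j i⁆ = -((2 : ℂ) • E j i) := by
    intro i j hij; simp only [hHdef, sub_lie, hE]; simp [hij, hij.symm, two_smul]; abel
  have htr : ∀ i j, ∃ r : ℝ, LinearMap.trace ℂ W (H i j * H i j) = r ∧ 0 ≤ r ∧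
      (r = 0 → IsNilpotent (H i j)) := by
    intro i j
    by_cases hij : i = j
    · subst hij; exact ⟨0, by simp [hHdef], le_rfl, fun _ => by simp [hHdef]⟩
    · exact trace_sq _ (sl2_int _ _ _ (hnil i j hij) (r1 i j hij) (r2 i j hij) (r3 i j hij))
  choose r hr1 hr2 hr3 using htr
  set tr := LinearMap.trace ℂ W
  have hXY : ∀ i j, i ≠ j → 2 * tr (E i j * E j i) = r i j := by
    intro i j hij
    rw [← hr1]
    have e1 : H i j * H i j = E i j * E j i * H i j - E j i * E i j * H i j := by
      conv_lhs => enter [1]; rw [← r1 i j hij]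
      rw [Ring.lie_def, sub_mul]
    have e2 : tr (E j i * E i j * H i j) = tr (E i j * (H i j * E j i)) := by
      rw [mul_assoc, LinearMap.trace_mul_comm, mul_assoc]
    rw [e1, map_sub, e2, ← map_sub, mul_assoc, ← mul_sub]
    have e3 : E j i * H i j - H i j * E j i = (2 : ℂ) • E j i := by
      rw [← neg_sub, ← Ring.lie_def, r3 i j hij, neg_neg]
    rw [e3, mul_smul_comm, map_smul, smul_eq_mul]
  have hHH : ∑ i, ∑ j, H i j * H i j = (2 * n : ℂ) • ∑ i, E i i * E i i := by
    have : ∀ i j, H i j * H i j = E i i * E i i - E i i * E j j - E j j * E i i + E j j * E j j := by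
      intro i j; simp only [hHdef]; noncomm_ring
    simp only [this, Finset.sum_add_distrib, Finset.sum_sub_distrib, ← Finset.mul_sum,
      ← Finset.sum_mul, hsum, Finset.sum_const, Finset.card_univ, Fintype.card_fin, mul_zero, zero_mul, sub_zero]
    simp only [mul_smul_comm]
    rw [← Finset.smul_sum, ← Nat.cast_smul_eq_nsmul ℂ, ← add_smul, two_mul]
  have hD : (2 * n : ℂ) * ∑ i, tr (E i i * E i i) = ∑ i, ∑ j, (r i j : ℂ) := by
    have := congrArg tr hHH
    simp only [map_sum, map_smul, smul_eq_mul, hr1] at this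
    rw [this]
  have hCt : ∑ i, ∑ j, tr (E i j * E j i) = 0 := by
    have := (LinearMap.isNilpotent_trace_of_isNilpotent hC).eq_zero
    simpa only [map_sum] using this
  have hspl : ∑ i, ∑ j, (2 * tr (E i j * E j i)) = ∑ i, 2 * tr (E i i * E i i) + ∑ i, ∑ j, (r i j : ℂ) := by
    rw [← Finset.sum_add_distrib]
    refine Finset.sum_congr rfl fun i _ => ?_
    have hrii : r i i = 0 := by
      have := hr1 i i
      simp [hHdef] at this
      exact_mod_cast this.symm
    rw [← Finset.add_sum_erase _ _ (Finset.mem_univ i), ← Finset.add_sum_erase _ (fun j => (r i j : ℂ)) (Finset.mem_univ i)]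
    rw [hrii]; simp only [Complex.ofReal_zero, zero_add]
    congr 1
    exact Finset.sum_congr rfl fun j hj => hXY i j (Finset.ne_of_mem_erase hj).symm
  have hS : ∑ i, ∑ j, (r i j : ℂ) = 0 := by
    simp only [← Finset.mul_sum] at hspl
    rw [hCt, mul_zero] at hspl
    have h5 : (n : ℂ) * 0 = (n + 1) * ∑ i, ∑ j, (r i j : ℂ) := by
      rw [hspl, mul_add, ← mul_assoc, mul_comm (n : ℂ) 2, hD]; ring
    rw [mul_zero] at h5
    have h6 : (n + 1 : ℂ) ≠ 0 := by exact_mod_cast Nat.succ_ne_zero n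
    exact (mul_eq_zero.1 h5.symm).resolve_left h6
  have hS' : ∑ i, ∑ j, r i j = 0 := by exact_mod_cast hS
  have hz : r i j = 0 := by
    have := (Finset.sum_eq_zero_iff_of_nonneg (fun i _ => Finset.sum_nonneg fun j _ => hr2 i j)).1 hS' i (Finset.mem_univ _)
    exact (Finset.sum_eq_zero_iff_of_nonneg (fun j _ => hr2 i j)).1 this j (Finset.mem_univ _)
  exact nil_lie _ _ (hr3 i j hz) (r2 i j hij)
end sl2

section gl
variable {L : Type} [LieRing L] [LieAlgebra ℂ L]

theorem gl_build {n : ℕ} (hn : 3 ≤ n) (X : Fin n → Fin n → L)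
    (h1 : ∀ i j k, i ≠ j → j ≠ k → i ≠ k → ⁅X i j, X j k⁆ = X i k)
    (h0 : ∀ i j k l, i ≠ j → k ≠ l → j ≠ k → i ≠ l → ⁅X i j, X k l⁆ = 0) :
    ∃ E : Fin n → Fin n → L, (∀ i j, i ≠ j → E i j = X i j) ∧ ∑ i, E i i = 0 ∧
      (∀ i, ∃ c : Fin n → ℂ, E i i = ∑ j, c j • ⁅X i j, X j i⁆) ∧
      ∀ i j k l, ⁅E i j, E k l⁆ = (if j = k then E i l else 0) - (if l = i then E k j else 0) := by
  have h1' : ∀ i j k, i ≠ j → j ≠ k → i ≠ k → ⁅X j k, X i j⁆ = - X i k := by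
    intro i j k a b c; rw [← lie_skew, h1 i j k a b c]
  set H : Fin n → Fin n → L := fun i j => ⁅X i j, X j i⁆ with hH
  set χ : Fin n → Fin n → Fin n → ℂ := fun i k l => (if i = k then 1 else 0) - (if i = l then 1 else 0) with hχ
  have third : ∀ i j : Fin n, ∃ p, p ≠ i ∧ p ≠ j := by
    intro i j
    by_contra! h
    have h2 : (Finset.univ : Finset (Fin n)) ⊆ {i, j} := by
      intro p _
      by_cases hp : p = i
      · simp [hp]
      · simp [h p hp]
    have h3 := (Finset.card_le_card h2).trans Finset.card_le_two
    simp at h3; omega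
  have hHii : ∀ i, H i i = 0 := fun i => lie_self _
  have hHsk : ∀ i j, H j i = - H i j := fun i j => (lie_skew _ _).symm
  -- four basic cases
  have hA : ∀ i j k l, i ≠ j → k ≠ l → ¬ (k = i ∧ l = j) → ¬ (k = j ∧ l = i) →
      ⁅H i j, X k l⁆ = (χ i k l - χ j k l) • X k l := by
    intro i j k l hij hkl hn1 hn2
    simp only [hH, hχ]
    rw [lie_lie]
    by_cases hki : k = i
    · subst hki
      have hlj : l ≠ j := fun h => hn1 ⟨rfl, h⟩
      rw [h1 j k l hij.symm hkl hlj.symm, h0 k j k l hij hkl hij.symm hkl,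
        h1 k j l hij hlj.symm hkl]
      simp [hkl, hij.symm, hlj.symm]
    by_cases hkj : k = j
    · subst hkj
      have hli : l ≠ i := fun h => hn2 ⟨rfl, h⟩
      rw [h0 k i k l hij.symm hkl hij hkl, h1 i k l hij hkl hli.symm,
        h1 k i l hij.symm hli.symm hkl]
      simp [hkl, hij, hli.symm]
    by_cases hli : l = i
    · subst hli
      rw [h0 j l k l hij.symm hkl (Ne.symm hkl) hij.symm, h1' k l j hkl hij hkj, lie_neg,
        h1' k j l hkj hij.symm hkl]
      simp [hkl.symm, hij.symm, Ne.symm hkj]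
    by_cases hlj : l = j
    · subst hlj
      rw [h1' k l i hkl hij.symm hki, lie_neg, h0 i l k l hij hkl (Ne.symm hkl) hij,
        h1' k i l hki hij hkl]
      simp [hkl.symm, hij, Ne.symm hki]
    rw [h0 j i k l hij.symm hkl (Ne.symm hki) (Ne.symm hlj),
      h0 i j k l hij hkl (Ne.symm hkj) (Ne.symm hli)]
    simp [Ne.symm hki, Ne.symm hkj, Ne.symm hli, Ne.symm hlj]
  have hB : ∀ i j k l, k ≠ l → ⁅H i j, X k l⁆ = (χ i k l - χ j k l) • X k l := by
    intro i j k l hkl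
    by_cases hij : i = j
    · subst hij; rw [hHii]; simp
    obtain ⟨p, hpk, hpl⟩ := third k l
    by_cases hcase : (k = i ∧ l = j) ∨ (k = j ∧ l = i)
    · have e1 : ⁅H i j, X k p⁆ = (χ i k p - χ j k p) • X k p := by
        apply hA i j k p hij hpk.symm
        · rintro ⟨rfl, rfl⟩; rcases hcase with ⟨_, h⟩ | ⟨h, _⟩
          · exact hpl h.symm
          · exact hij h
        · rintro ⟨rfl, rfl⟩; rcases hcase with ⟨h, _⟩ | ⟨_, h⟩
          · exact hij h.symm
          · exact hpl h.symm
      have e2 : ⁅H i j, X p l⁆ = (χ i p l - χ j p l) • X p l := by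
        apply hA i j p l hij hpl
        · rintro ⟨rfl, rfl⟩; rcases hcase with ⟨h, _⟩ | ⟨_, h⟩
          · exact hpk h.symm
          · exact hij h.symm
        · rintro ⟨rfl, rfl⟩; rcases hcase with ⟨_, h⟩ | ⟨h, _⟩
          · exact hij h
          · exact hpk h.symm
      rw [← h1 k p l hpk.symm hpl hkl, leibniz_lie, e1, e2, lie_smul, smul_lie, ← add_smul]
      congr 1
      simp only [hχ]; ring
    · push Not at hcase
      exact hA i j k l hij hkl (fun h => hcase.1 h.1 h.2) (fun h => hcase.2 h.1 h.2)
  have hadd : ∀ i j k, H i j + H j k = H i k := by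
    intro i j k
    by_cases hij : i = j
    · subst hij; rw [hHii, zero_add]
    by_cases hjk : j = k
    · subst hjk; rw [hHii, add_zero]
    by_cases hik : i = k
    · subst hik; rw [hHii, hHsk i j, add_neg_cancel]
    simp only [hH]
    rw [← h1 i j k hij hjk hik, lie_lie, h1 j k i hjk (Ne.symm hik) (Ne.symm hij),
      h1' k i j (Ne.symm hik) hij (Ne.symm hjk), lie_neg, sub_neg_eq_add]
  have hn0 : (n : ℂ) ≠ 0 := by
    have : n ≠ 0 := by omega
    exact_mod_cast this
  set D : Fin n → L := fun i => (n : ℂ)⁻¹ • ∑ j, H i j with hD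
  have hDX : ∀ i k l, k ≠ l → ⁅D i, X k l⁆ = χ i k l • X k l := by
    intro i k l hkl
    simp only [hD]
    rw [smul_lie, sum_lie]
    rw [Finset.sum_congr rfl (fun j _ => hB i j k l hkl), ← Finset.sum_smul, smul_smul]
    congr 1
    rw [Finset.sum_sub_distrib]
    have : ∑ j, χ j k l = 0 := by simp [hχ]
    rw [this]
    simp [hn0]
  have hDH : ∀ i k l, ⁅D i, H k l⁆ = 0 := by
    intro i k l
    by_cases hkl : k = l
    · subst hkl; rw [hHii, lie_zero]
    simp only [hH]
    rw [leibniz_lie, hDX i k l hkl, hDX i l k (Ne.symm hkl), lie_smul, smul_lie, ← add_smul]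
    have : χ i k l + χ i l k = 0 := by simp only [hχ]; ring
    rw [this, zero_smul]
  have hDD : ∀ i j, ⁅D i, D j⁆ = 0 := by
    intro i j
    show ⁅D i, (n : ℂ)⁻¹ • ∑ k, H j k⁆ = 0
    rw [lie_smul, lie_sum]
    simp [hDH]
  have hDsub : ∀ i j, D i - D j = H i j := by
    intro i j
    simp only [hD]
    rw [← smul_sub, ← Finset.sum_sub_distrib]
    have : ∀ k, H i k - H j k = H i j := by
      intro k; rw [← hadd i j k]; abel
    simp only [this, Finset.sum_const, Finset.card_univ, Fintype.card_fin]
    rw [← Nat.cast_smul_eq_nsmul ℂ, smul_smul, inv_mul_cancel₀ hn0, one_smul]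
  refine ⟨fun i j => if i = j then D i else X i j, ?_, ?_, ?_, ?_⟩
  · intro i j hij; simp [hij]
  · simp only [if_true, hD]
    rw [← Finset.smul_sum]
    have h2 : ∑ i, ∑ j, H i j = - ∑ i, ∑ j, H i j := by
      conv_lhs => rw [Finset.sum_comm]
      rw [← Finset.sum_neg_distrib]
      refine Finset.sum_congr rfl fun i _ => ?_
      rw [← Finset.sum_neg_distrib]
      exact Finset.sum_congr rfl fun j _ => hHsk i j
    have h3 : (2 : ℂ) • ∑ i, ∑ j, H i j = 0 := by
      rw [two_smul]; nth_rewrite 2 [h2]; simp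
    rw [(smul_eq_zero.1 h3).resolve_left two_ne_zero, smul_zero]
  · intro i
    exact ⟨fun _ => (n : ℂ)⁻¹, by simp only [if_true, hD]; rw [Finset.smul_sum]⟩
  · intro i j k l
    by_cases hij : i = j
    · subst hij
      by_cases hkl : k = l
      · subst hkl
        simp only [if_true, hDD]
        by_cases hik : i = k
        · subst hik; simp
        · simp [hik, Ne.symm hik]
      · simp only [if_true, if_neg hkl, hDX i k l hkl, hχ]
        by_cases hik : i = k
        · subst hik; simp [hkl, Ne.symm hkl]
        · by_cases hil : i = l
          · subst hil; simp [hik, Ne.symm hik]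
          · simp [hik, hil, Ne.symm hil]
    · by_cases hkl : k = l
      · subst hkl
        simp only [if_true, if_neg hij]
        rw [← lie_skew, hDX k i j hij]
        simp only [hχ]
        by_cases hik : k = i
        · subst hik; simp [hij, Ne.symm hij]
        · by_cases hjk : k = j
          · subst hjk; simp [hik, hij]
          · simp [hik, hjk, Ne.symm hjk]
      · simp only [if_neg hij, if_neg hkl]
        by_cases hjk : j = k
        · subst hjk
          by_cases hil : l = i
          · subst hil
            simp only [if_true]
            rw [hDsub]
          · simp only [if_true, if_neg hil, sub_zero, if_neg (Ne.symm hil)]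
            exact h1 i j l hij hkl (Ne.symm hil)
        · by_cases hil : l = i
          · subst hil
            simp only [if_true, if_neg hjk, zero_sub, if_neg (Ne.symm hjk)]
            exact h1' k l j hkl hij (Ne.symm hjk)
          · simp only [if_neg hjk, if_neg hil, sub_zero]
            exact h0 i j k l hij hkl hjk (Ne.symm hil)
end gl
section lf
attribute [local instance] LieRing.ofAssociativeRing
variable {W : Type} [AddCommGroup W] [Module ℂ W] [FiniteDimensional ℂ W]

theorem casimir_comm {A : Type} [Ring A] {n : ℕ} (E : Fin n → Fin n → A)
    (hE : ∀ i j k l, E i j * E k l - E k l * E i j =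
      (if j = k then E i l else 0) - (if l = i then E k j else 0)) (k l : Fin n) :
    Commute (∑ i, ∑ j, E i j * E j i) (E k l) := by
  have h : E k l * (∑ i, ∑ j, E i j * E j i) - (∑ i, ∑ j, E i j * E j i) * E k l = 0 := by
    have h2 : ∀ i j, E k l * (E i j * E j i) - (E i j * E j i) * E k l =
        (if l = i then E k j * E j i else 0) - (if j = k then E i l * E j i else 0)
        + ((if l = j then E i j * E k i else 0) - (if i = k then E i j * E j l else 0)) := by
      intro i j
      have : E k l * (E i j * E j i) - (E i j * E j i) * E k l =
        (E k l * E i j - E i j * E k l) * E j i + E i j * (E k l * E j i - E j i * E k l) := by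
        noncomm_ring
      rw [this, hE, hE]
      simp only [sub_mul, mul_sub, ite_mul, mul_ite, zero_mul, mul_zero]
    rw [Finset.mul_sum, Finset.sum_mul, ← Finset.sum_sub_distrib]
    simp only [Finset.mul_sum, Finset.sum_mul, ← Finset.sum_sub_distrib, h2]
    simp only [Finset.sum_add_distrib, Finset.sum_sub_distrib]
    have s1 : ∑ x, ∑ x_1, (if l = x then E k x_1 * E x_1 x else 0) = ∑ j, E k j * E j l := by
      rw [Finset.sum_comm]; simp
    have s2 : ∑ x, ∑ x_1, (if x = k then E x x_1 * E x_1 l else 0) = ∑ j, E k j * E j l := by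
      rw [Finset.sum_comm]; simp
    rw [s1, s2]
    simp
  exact (sub_eq_zero.1 h).symm

theorem lie_fix {n : ℕ} (hn : 3 ≤ n) (X : Fin n → Fin n → Module.End ℂ W)
    (h1 : ∀ i j k, i ≠ j → j ≠ k → i ≠ k → X i j * X j k - X j k * X i j = X i k)
    (h0 : ∀ i j k l, i ≠ j → k ≠ l → j ≠ k → i ≠ l → X i j * X k l - X k l * X i j = 0)
    (hnil : ∀ i j, i ≠ j → IsNilpotent (X i j)) (φ : W →ₗ[ℂ] ℂ) (hφ0 : φ ≠ 0)
    (hφ : ∀ i j, i ≠ j → ∀ w, φ (X i j w) = 0) :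
    ∃ w, φ w ≠ 0 ∧ ∀ i j, i ≠ j → X i j w = 0 := by
  obtain ⟨E, hEX, hEs, hEd, hE⟩ := gl_build hn X (fun i j k a b c => h1 i j k a b c)
    (fun i j k l a b c d => h0 i j k l a b c d)
  have hE' : ∀ i j k l, E i j * E k l - E k l * E i j =
      (if j = k then E i l else 0) - (if l = i then E k j else 0) := hE
  set C := ∑ i, ∑ j, E i j * E j i with hC
  have hcomm : ∀ k l, Commute C (E k l) := casimir_comm E hE'
  have hφE : ∀ i j w, φ (E i j w) = 0 := by
    intro i j w
    by_cases hij : i = j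
    · subst hij
      obtain ⟨c, hc⟩ := hEd i
      rw [hc, LinearMap.sum_apply, map_sum]
      refine Finset.sum_eq_zero fun j _ => ?_
      by_cases hij : i = j
      · subst hij; rw [lie_self]; simp
      rw [LinearMap.smul_apply, map_smul, Ring.lie_def, LinearMap.sub_apply, map_sub,
        Module.End.mul_apply, Module.End.mul_apply, hφ i j hij, hφ j i (Ne.symm hij)]
      simp
    · rw [hEX i j hij, hφ i j hij]
  have hφC : ∀ w, φ (C w) = 0 := by
    intro w
    simp only [hC, LinearMap.sum_apply, map_sum, Module.End.mul_apply, hφE]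
    simp
  obtain ⟨k, hk, hk1⟩ := ((LinearMap.eventually_isCompl_ker_pow_range_pow C).and
    (Filter.eventually_ge_atTop 1)).exists
  set W0 := LinearMap.ker (C ^ k) with hW0
  have hw : ∃ w ∈ W0, φ w ≠ 0 := by
    by_contra! hcon
    apply hφ0
    ext w
    have hw : w ∈ W0 ⊔ LinearMap.range (C ^ k) := by rw [hk.sup_eq_top]; trivial
    obtain ⟨a, ha, b, ⟨c, rfl⟩, rfl⟩ := Submodule.mem_sup.1 hw
    obtain ⟨k', rfl⟩ := Nat.exists_eq_succ_of_ne_zero (by omega : k ≠ 0)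
    rw [map_add, hcon a ha, pow_succ', Module.End.mul_apply, hφC]
    simp
  have hinv : ∀ A : Module.End ℂ W, Commute C A → ∀ w ∈ W0, A w ∈ W0 := by
    intro A hA w hw
    rw [hW0, LinearMap.mem_ker] at hw ⊢
    rw [← Module.End.mul_apply, (hA.pow_left k).eq, Module.End.mul_apply, hw, map_zero]
  set E0 : Fin n → Fin n → Module.End ℂ W0 := fun i j => (E i j).restrict (hinv _ (hcomm i j)) with hE0
  have hE0a : ∀ i j (w : W0), ((E0 i j w : W0) : W) = E i j w := fun i j w => rfl
  have hz : ∀ i j, i ≠ j → E0 i j = 0 := by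
    intro i j hij
    refine gl_vanish (by omega) E0 ?_ ?_ ?_ ?_ i j hij
    · intro i j k l
      rw [Ring.lie_def]
      ext w
      have h5 := congrArg (fun f => f (w : W)) (hE' i j k l)
      simp only [LinearMap.sub_apply, Module.End.mul_apply] at h5
      simp only [LinearMap.sub_apply, Module.End.mul_apply, Submodule.coe_sub, hE0a]
      rw [h5]
      split_ifs <;> simp [hE0a]
    · ext w
      have h5 := congrArg (fun f => f (w : W)) hEs
      simp only [LinearMap.sum_apply] at h5
      simp only [LinearMap.sum_apply, Submodule.coe_sum, hE0a]
      rw [h5]; simp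
    · intro i j hij
      obtain ⟨N, hN⟩ := hnil i j hij
      refine ⟨N, ?_⟩
      rw [hE0]
      rw [Module.End.pow_restrict]
      ext w
      rw [LinearMap.coe_restrict_apply, hEX i j hij, hN]
      simp
    · refine ⟨k, ?_⟩
      have : (∑ i, ∑ j, E0 i j * E0 j i) = C.restrict (hinv C (Commute.refl C)) := by
        ext w
        simp only [LinearMap.sum_apply, Submodule.coe_sum, Module.End.mul_apply, hE0a,
          LinearMap.coe_restrict_apply, hC]
      rw [this, Module.End.pow_restrict]
      ext w
      rw [LinearMap.coe_restrict_apply]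
      simpa using w.2
  obtain ⟨w, hw, hφw⟩ := hw
  refine ⟨w, hφw, fun i j hij => ?_⟩
  rw [← hEX i j hij, ← hE0a i j ⟨w, hw⟩, hz i j hij]; simp
end lf

theorem eig_root {W : Type} [AddCommGroup W] [Module ℂ W]
    [FiniteDimensional ℂ W] (a b z : Module.End ℂ W) (ha : IsUnit a) (hb : IsUnit b)
    (hab : a * b = z * (b * a)) (hza : Commute z a) (hzb : Commute z b) (μ : ℂ)
    (hμ : z.HasEigenvalue μ) : μ ^ (Module.finrank ℂ W).factorial = 1 := by
  set U := z.eigenspace μ with hU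
  have hinv : ∀ f : Module.End ℂ W, Commute z f → ∀ x ∈ U, f x ∈ U := by
    intro f hf x hx
    rw [hU, Module.End.mem_eigenspace_iff] at hx ⊢
    rw [← Module.End.mul_apply, hf.eq, Module.End.mul_apply, hx, map_smul]
  have hdet : ∀ (f : Module.End ℂ W) (hf : Commute z f), IsUnit f →
      LinearMap.det (f.restrict (hinv f hf)) ≠ 0 := by
    intro f hf hu h0
    have hinj : Function.Injective (f.restrict (hinv f hf)) := by
      intro x y hxy
      have := ((Module.End.isUnit_iff f).1 hu).1 (congrArg Subtype.val hxy)
      exact Subtype.ext this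
    have : IsUnit (f.restrict (hinv f hf)) :=
      (Module.End.isUnit_iff _).2 ⟨hinj, LinearMap.surjective_of_injective hinj⟩
    exact (this.map (LinearMap.det (M := U))).ne_zero h0
  have key : a.restrict (hinv a hza) * b.restrict (hinv b hzb) =
      μ • (b.restrict (hinv b hzb) * a.restrict (hinv a hza)) := by
    ext x
    have h := LinearMap.congr_fun hab (x : W)
    have h2 := Module.End.mem_eigenspace_iff.1 (hinv b hzb _ (hinv a hza _ x.2))
    simp only [Module.End.mul_apply] at h
    rw [h2] at h
    simpa using h
  have h := congrArg LinearMap.det key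
  rw [LinearMap.det_smul, map_mul, map_mul, mul_comm (LinearMap.det (b.restrict _))] at h
  have h3 : μ ^ Module.finrank ℂ U = 1 := by
    have h4 := mul_ne_zero (hdet a hza ha) (hdet b hzb hb)
    exact (mul_right_cancel₀ h4 (by rw [← h, one_mul]))
  have hpos : 0 < Module.finrank ℂ U := by
    rw [Module.finrank_pos_iff, Submodule.nontrivial_iff_ne_bot]
    exact hμ
  obtain ⟨k, hk⟩ := Nat.dvd_factorial hpos (Submodule.finrank_le U)
  rw [hk, pow_mul, h3, one_pow]

theorem unip {W : Type} [AddCommGroup W] [Module ℂ W]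
    [FiniteDimensional ℂ W] (a b z : Module.End ℂ W) (ha : IsUnit a) (hb : IsUnit b)
    (hab : a * b = z * (b * a)) (hza : Commute z a) (hzb : Commute z b) :
    IsNilpotent (z ^ (Module.finrank ℂ W).factorial - 1) := by
  set k := (Module.finrank ℂ W).factorial
  refine ⟨Module.finrank ℂ W, ?_⟩
  rw [← LinearMap.ker_eq_top, eq_top_iff, ← Module.End.iSup_maxGenEigenspace_eq_top z]
  refine iSup_le fun μ => ?_
  by_cases hμ : z.HasEigenvalue μ
  · have h1 := eig_root a b z ha hb hab hza hzb μ hμ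
    have hc : Commute z (algebraMap ℂ (Module.End ℂ W) μ) := (Algebra.commutes μ z).symm
    have h2 : z ^ k - 1 = (∑ i ∈ Finset.range k, z ^ i * (algebraMap ℂ (Module.End ℂ W) μ) ^ (k - 1 - i)) * (z - algebraMap ℂ (Module.End ℂ W) μ)  := by
      rw [hc.geom_sum₂_mul, ← map_pow, h1, map_one]
    intro x hx
    rw [Module.End.maxGenEigenspace_eq_genEigenspace_finrank, Module.End.mem_genEigenspace_nat] at hx
    have hx' : ((z - algebraMap ℂ (Module.End ℂ W) μ) ^ Module.finrank ℂ W) x = 0 := by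
      simpa [Algebra.algebraMap_eq_smul_one] using hx
    rw [LinearMap.mem_ker, h2, Commute.mul_pow, Module.End.mul_apply, hx', map_zero]
    refine Commute.sub_right ?_ ?_
    · refine Commute.sum_left _ _ _ fun i _ => ?_
      exact ((Commute.refl z).pow_left i).mul_left (hc.symm.pow_left _)
    · exact (Algebra.commutes μ _).symm
  · have : z.maxGenEigenspace μ = ⊥ := by
      by_contra h
      apply hμ
      rw [Module.End.maxGenEigenspace_eq_genEigenspace_finrank] at h
      exact Module.End.hasEigenvalue_of_hasGenEigenvalue (k := Module.finrank ℂ W) h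
    rw [this]; exact bot_le

section logs
variable {A : Type} [Ring A] [Algebra ℚ A]

theorem exp_form (X : A) (hX : IsNilpotent X) :
    ∃ s, Commute X s ∧ IsNilpotent.exp X = 1 + X + X * (X * s) := by
  obtain ⟨k, hk⟩ := hX
  have hk' : X ^ (k + 1 + 1) = 0 := by rw [pow_add, pow_add, hk]; simp
  refine ⟨∑ i ∈ Finset.range k, ((i + 1 + 1).factorial : ℚ)⁻¹ • X ^ i, ?_, ?_⟩
  · exact Commute.sum_right _ _ _ fun i _ => ((Commute.refl X).pow_right i).smul_right _
  · rw [IsNilpotent.exp_eq_sum hk', Finset.sum_range_succ', Finset.sum_range_succ']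
    simp only [Finset.mul_sum, mul_smul_comm, ← pow_succ']
    simp
    abel

theorem exp_eq_one (X : A) (hX : IsNilpotent X) (h : IsNilpotent.exp X = 1) : X = 0 := by
  obtain ⟨s, hs, he⟩ := exp_form X hX
  have h1 : X * (1 + X * s) = 0 := by
    rw [h] at he
    rw [mul_add, mul_one]
    have : (1 : A) + (X + X * (X * s)) = 1 := by rw [← add_assoc]; exact he.symm
    simpa using this
  have h2 : IsUnit (1 + X * s) := IsNilpotent.isUnit_one_add (hs.isNilpotent_mul_right hX)
  exact (h2.mul_left_eq_zero).1 h1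

/-- `X` is the logarithm of the unipotent element `u`. -/
structure IsLog (u X : A) : Prop where
  mem : X ∈ Algebra.adjoin ℚ {u}
  nil : IsNilpotent X
  exp : IsNilpotent.exp X = u

theorem commute_adjoin {g u X : A} (h : Commute g u) (hX : X ∈ Algebra.adjoin ℚ {u}) :
    Commute g X := by
  induction hX using Algebra.adjoin_induction with
  | mem x hx => rw [Set.mem_singleton_iff] at hx; rw [hx]; exact h
  | algebraMap r => exact (Algebra.commutes r g).symm
  | add x y _ _ hx hy => exact hx.add_right hy
  | mul x y _ _ hx hy => exact hx.mul_right hy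

theorem IsLog.commute {g u X : A} (hX : IsLog u X) (h : Commute g u) : Commute g X :=
  commute_adjoin h hX.mem

theorem commute_exp {g X : A} (hX : IsNilpotent X) (h : Commute g X) :
    Commute g (IsNilpotent.exp X) := by
  obtain ⟨k, hk⟩ := hX
  rw [IsNilpotent.exp_eq_sum hk]
  exact Commute.sum_right _ _ _ fun i _ => (h.pow_right i).smul_right _

theorem IsLog.unique {u X Y : A} (hX : IsLog u X) (hY : IsNilpotent Y)
    (h : IsNilpotent.exp Y = u) : X = Y := by
  have hc : Commute Y X := hX.commute (h ▸ commute_exp hY (Commute.refl Y))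
  rw [← sub_eq_zero]
  have hc' : Commute X (-Y) := hc.symm.neg_right
  apply exp_eq_one
  · rw [sub_eq_add_neg]; exact hc'.isNilpotent_add hX.nil hY.neg
  · rw [sub_eq_add_neg, IsNilpotent.exp_add_of_commute hc' hX.nil hY.neg, hX.exp, ← h,
      IsNilpotent.exp_mul_exp_neg_self hY]

theorem IsLog.mul {u v X Y Z : A} (huv : Commute u v) (hX : IsLog u X) (hY : IsLog v Y)
    (hZ : IsLog (u * v) Z) : Z = X + Y := by
  have hc : Commute X Y := hY.commute (hX.commute huv.symm).symm
  exact hZ.unique (hc.isNilpotent_add hX.nil hY.nil)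
    (by rw [IsNilpotent.exp_add_of_commute hc hX.nil hY.nil, hX.exp, hY.exp])

theorem IsLog.conj {g u u' X X' : A} (hg : IsUnit g) (h : g * u = u' * g) (hX : IsLog u X)
    (hX' : IsLog u' X') : g * X = X' * g := by
  obtain ⟨g, rfl⟩ := hg
  have : X' = ConjAct.toConjAct g • X := by
    apply hX'.unique
    · obtain ⟨k, hk⟩ := hX.nil
      exact ⟨k, by rw [← smul_pow', hk, smul_zero]⟩
    · rw [IsNilpotent.exp_smul _ hX.nil, hX.exp, ConjAct.units_smul_def, ConjAct.ofConjAct_toConjAct, h,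
        mul_assoc, Units.mul_inv, mul_one]
  rw [this, ConjAct.units_smul_def, ConjAct.ofConjAct_toConjAct, mul_assoc, mul_assoc, Units.inv_mul, mul_one]

theorem IsLog.lie {u X Y Z : A} (hX : IsLog u X) (h : u * Y = (Y + Z) * u) (hZ : Commute Z u) :
    X * Y - Y * X = Z := by
  have key : ∀ x ∈ Algebra.adjoin ℚ {u}, Commute u (x * Y - Y * x) := by
    intro x hx
    induction hx using Algebra.adjoin_induction with
    | mem x hx =>
      rw [Set.mem_singleton_iff] at hx; rw [hx, h, add_mul, add_sub_cancel_left]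
      exact hZ.symm.mul_right (Commute.refl u)
    | algebraMap r => rw [Algebra.commutes, sub_self]; exact Commute.zero_right _
    | add x y _ _ hx hy =>
      have : (x + y) * Y - Y * (x + y) = (x * Y - Y * x) + (y * Y - Y * y) := by noncomm_ring
      rw [this]; exact hx.add_right hy
    | mul x y hx' hy' hx hy =>
      have : (x * y) * Y - Y * (x * y) = (x * Y - Y * x) * y + x * (y * Y - Y * y) := by noncomm_ring
      rw [this]
      exact (hx.mul_right (commute_adjoin (Commute.refl u) hy')).add_right
        ((commute_adjoin (Commute.refl u) hx').mul_right hy)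
  have hE : Commute (X * Y - Y * X) X := hX.commute (key X hX.mem).symm
  set E := X * Y - Y * X with hEdef
  have hpow : ∀ i : ℕ, X ^ (i + 1) * Y = Y * X ^ (i + 1) + ((i : ℚ) + 1) • (X ^ i * E) := by
    intro i
    induction i with
    | zero => simp [hEdef]
    | succ i ih =>
      have h1 : X * Y = Y * X + E := by rw [hEdef]; abel
      rw [pow_succ' X (i + 1), mul_assoc, ih, mul_add, ← mul_assoc, h1, mul_smul_comm, ← mul_assoc,
        ← pow_succ', add_mul, (hE.pow_right (i + 1)).eq, mul_assoc]
      push_cast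
      rw [add_assoc, add_smul ((i : ℚ) + 1) 1, one_smul]
      abel
  obtain ⟨k, hk⟩ := hX.nil
  have hk' : X ^ (k + 1) = 0 := by rw [pow_succ, hk, zero_mul]
  have hs : u * Y = Y * u + u * E := by
    have e1 : u = (∑ i ∈ Finset.range k, ((i + 1).factorial : ℚ)⁻¹ • X ^ (i + 1)) + 1 := by
      rw [← hX.exp, IsNilpotent.exp_eq_sum hk', Finset.sum_range_succ']; simp
    have e2 : u = ∑ i ∈ Finset.range k, (i.factorial : ℚ)⁻¹ • X ^ i := by
      rw [← hX.exp, IsNilpotent.exp_eq_sum hk]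
    have e3 : u * E = ∑ i ∈ Finset.range k, (i.factorial : ℚ)⁻¹ • (X ^ i * E) := by
      conv_lhs => rw [e2]
      rw [Finset.sum_mul]; simp
    rw [e3]
    conv_lhs => rw [e1]
    conv_rhs => rw [e1]
    rw [add_mul, mul_add, Finset.sum_mul, Finset.mul_sum, add_right_comm, ← Finset.sum_add_distrib,
      one_mul, mul_one]
    congr 1
    refine Finset.sum_congr rfl fun i _ => ?_
    rw [smul_mul_assoc, hpow, smul_add, mul_smul_comm, smul_smul, Nat.factorial_succ]
    congr 2
    push_cast
    field_simp
  rw [h, add_mul] at hs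
  have h2 : u * E = u * Z := by rw [← hZ.eq]; exact (add_left_cancel hs).symm
  have hu : IsUnit u := hX.exp ▸ IsNilpotent.isUnit_exp hX.nil
  exact hu.mul_left_cancel h2

theorem log_comm {S : Type} [CommRing S] [Algebra ℚ S] (N : ℕ) (u : S)
    (hu : IsNilpotent (u - 1)) : ∃ r : S, IsNilpotent r ∧
      ∑ i ∈ Finset.range (N + 2), (i.factorial : ℚ)⁻¹ • r ^ i = u := by
  let P : Polynomial S := (∑ i ∈ Finset.range (N + 2),
    Polynomial.C (algebraMap ℚ S (i.factorial : ℚ)⁻¹) * Polynomial.X ^ i) - Polynomial.C u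
  have hv : ∀ r : S, Polynomial.aeval r P =
      (∑ i ∈ Finset.range (N + 2), (i.factorial : ℚ)⁻¹ • r ^ i) - u := by
    intro r
    simp only [P, map_sub, map_sum, map_mul, map_pow, Polynomial.aeval_C, Polynomial.aeval_X,
      Algebra.smul_def, Algebra.algebraMap_self, RingHom.id_apply]
  have h0 : Polynomial.aeval (0 : S) P = 1 - u := by
    rw [hv, Finset.sum_range_succ']; simp
  have h1 : Polynomial.aeval (0 : S) (Polynomial.derivative P) = 1 := by
    simp only [P, Polynomial.derivative_sub, Polynomial.derivative_sum, Polynomial.derivative_C,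
      Polynomial.derivative_C_mul_X_pow, map_sub, map_sum, map_mul, map_pow, Polynomial.aeval_C,
      Polynomial.aeval_X, Algebra.algebraMap_self, RingHom.id_apply, map_zero, sub_zero]
    rw [Finset.sum_range_succ', Finset.sum_range_succ', Finset.sum_eq_zero]
    · simp
    · intro i _
      rw [Nat.add_sub_cancel, pow_succ, mul_zero, mul_zero]
  obtain ⟨r, ⟨hr1, hr2⟩, -⟩ := Polynomial.existsUnique_nilpotent_sub_and_aeval_eq_zero
    (x := (0 : S)) (P := P) (by rw [h0, ← neg_sub]; exact hu.neg) (by rw [h1]; exact isUnit_one)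
  exact ⟨r, by simpa using hr1, by rwa [hv, sub_eq_zero] at hr2⟩

theorem exists_log (N : ℕ) (hN : ∀ x : A, IsNilpotent x → x ^ N = 0) (u : A)
    (hu : IsNilpotent (u - 1)) : ∃ X, IsLog u X := by
  have hN2 : ∀ x : A, IsNilpotent x → x ^ (N + 2) = 0 := fun x hx => by
    rw [pow_add, hN x hx, zero_mul]
  have hcomm : IsMulCommutative (Algebra.adjoin ℚ {u}) := Algebra.isMulCommutative_adjoin ℚ (by
    intro a ha b hb; rw [Set.mem_singleton_iff] at ha hb; rw [ha, hb])
  obtain ⟨r, hr1, hr2⟩ := log_comm (S := Algebra.adjoin ℚ {u}) N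
    ⟨u, Algebra.subset_adjoin rfl⟩ (by
      obtain ⟨k, hk⟩ := hu
      exact ⟨k, Subtype.ext (by simpa using hk)⟩)
  have hrn : IsNilpotent (r : A) := hr1.map (Algebra.adjoin ℚ {u}).val
  refine ⟨r, r.2, hrn, ?_⟩
  have := congrArg (Algebra.adjoin ℚ {u}).val hr2
  rw [IsNilpotent.exp_eq_sum (hN2 _ hrn)]
  simpa using this
end logs
section logpart
variable {W : Type} [AddCommGroup W] [Module ℂ W] [FiniteDimensional ℂ W]

theorem third_index {n : ℕ} (hn : 3 ≤ n) (i j : Fin n) : ∃ p, p ≠ i ∧ p ≠ j := by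
  by_contra! h
  have h2 : (Finset.univ : Finset (Fin n)) ⊆ {i, j} := by
    intro p _
    by_cases hp : p = i
    · simp [hp]
    · simp [h p hp]
  have h3 := (Finset.card_le_card h2).trans Finset.card_le_two
  simp at h3; omega

theorem unip_mul {A : Type} [Ring A] {u v : A} (h : Commute u v) (hu : IsNilpotent (u - 1))
    (hv : IsNilpotent (v - 1)) : IsNilpotent (u * v - 1) := by
  have e : u * v - 1 = (u - 1) * v + (v - 1) := by noncomm_ring
  rw [e]
  have c1 : Commute (u - 1) v := h.sub_left (Commute.one_left v)
  have c2 : Commute ((u - 1) * v) (v - 1) :=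
    Commute.sub_right (Commute.mul_left c1 (Commute.refl v)) (Commute.one_right _)
  exact c2.isNilpotent_add (c1.isNilpotent_mul_right hu) hv

theorem log_fix {n : ℕ} (hn : 3 ≤ n) {Γ : Type} [Group Γ] (e : Fin n → Fin n → Γ)
    (s1 : ∀ i j k, i ≠ j → j ≠ k → i ≠ k → e i j * e j k = e i k * e j k * e i j)
    (s0 : ∀ i j k l, i ≠ j → k ≠ l → j ≠ k → i ≠ l → Commute (e i j) (e k l))
    (ρ : Γ →* Module.End ℂ W) (φ : W →ₗ[ℂ] ℂ) (hφ : ∀ g w, φ (ρ g w) = φ w) (hφ0 : φ ≠ 0) :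
    ∃ m : ℕ, 0 < m ∧ ∃ M : Submodule ℂ W, (∃ w ∈ M, φ w ≠ 0) ∧
      (∀ i j, i ≠ j → ∀ w ∈ M, ρ (e i j) w ∈ M) ∧
      (∀ i j, i ≠ j → ∀ w ∈ M, ρ (e i j ^ m) w = w) := by
  letI : Algebra ℚ (Module.End ℂ W) := Algebra.compHom _ (algebraMap ℚ ℂ)
  have hbd : ∀ x : Module.End ℂ W, IsNilpotent x → x ^ Module.finrank ℂ W = 0 := by
    intro x hx
    have h1 := (LinearMap.isNilpotent_iff_charpoly x).1 hx
    have h2 := x.aeval_self_charpoly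
    rw [h1] at h2
    simpa using h2
  have hun : ∀ g : Γ, IsUnit (ρ g) := fun g => (Group.isUnit g).map ρ
  set m := (Module.finrank ℂ W).factorial with hm
  have hm0 : 0 < m := Nat.factorial_pos _
  have hmC : (m : ℂ) ≠ 0 := by exact_mod_cast hm0.ne'
  set u : Fin n → Fin n → Module.End ℂ W := fun i j => ρ (e i j ^ m) with hu
  have hnil : ∀ i j, i ≠ j → IsNilpotent (u i j - 1) := by
    intro i j hij
    obtain ⟨k, hki, hkj⟩ := third_index hn i j
    simp only [hu, map_pow]
    apply unip (ρ (e i k)) (ρ (e k j)) _ (hun _) (hun _)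
    · rw [← map_mul, s1 i k j hki.symm hkj hij, map_mul, map_mul, mul_assoc]
    · exact (s0 i j i k hij hki.symm hij.symm hki.symm).map ρ
    · exact (s0 i j k j hij hkj hkj.symm hij).map ρ
  have hlog : ∀ i j, ∃ X, i ≠ j → IsLog (u i j) X := by
    intro i j
    by_cases hij : i = j
    · exact ⟨0, fun h => absurd hij h⟩
    · obtain ⟨X, hX⟩ := exists_log _ hbd _ (hnil i j hij)
      exact ⟨X, fun _ => hX⟩
  choose Y hY using hlog
  -- commuting relations
  have c0 : ∀ i j k l, i ≠ j → k ≠ l → j ≠ k → i ≠ l → Commute (ρ (e i j)) (Y k l) := by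
    intro i j k l hij hkl hjk hil
    exact (hY k l hkl).commute (((s0 i j k l hij hkl hjk hil).pow_right m).map ρ)
  have c1 : ∀ i j k, i ≠ j → j ≠ k → i ≠ k →
      ρ (e i j) * Y j k = (Y i k + Y j k) * ρ (e i j) := by
    intro i j k hij hjk hik
    have hc : Commute (e i k) (e j k) := s0 i k j k hik hjk hjk.symm hik
    have hcu : Commute (u i k) (u j k) := (hc.pow_pow m m).map ρ
    obtain ⟨Z, hZ⟩ := exists_log _ hbd _ (unip_mul hcu (hnil i k hik) (hnil j k hjk))
    have hZe := IsLog.mul hcu (hY i k hik) (hY j k hjk) hZ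
    rw [← hZe]
    refine IsLog.conj (hun _) ?_ (hY j k hjk) hZ
    have : SemiconjBy (e i j) (e j k) (e i k * e j k) := s1 i j k hij hjk hik
    have h2 := (this.pow_right m).eq
    rw [hc.mul_pow] at h2
    simp only [hu, ← map_mul]
    rw [h2]
  have c2 : ∀ i j l, i ≠ j → j ≠ l → i ≠ l →
      ρ (e j l) * (Y i l + Y i j) = Y i j * ρ (e j l) := by
    intro i j l hij hjl hil
    have hc : Commute (e i l) (e i j) := s0 i l i j hil hij hil.symm hij
    have hcu : Commute (u i l) (u i j) := (hc.pow_pow m m).map ρ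
    obtain ⟨Z, hZ⟩ := exists_log _ hbd _ (unip_mul hcu (hnil i l hil) (hnil i j hij))
    have hZe := IsLog.mul hcu (hY i l hil) (hY i j hij) hZ
    rw [← hZe]
    refine IsLog.conj (hun _) ?_ hZ (hY i j hij)
    have hc2 : Commute (e i l) (e j l) := s0 i l j l hil hjl hjl.symm hil
    have : SemiconjBy (e j l) (e i l * e i j) (e i j) := by
      show e j l * (e i l * e i j) = e i j * e j l
      rw [s1 i j l hij hjl hil, ← mul_assoc, hc2.eq]
    have h2 := (this.pow_right m).eq
    rw [hc.mul_pow] at h2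
    simp only [hu, ← map_mul]
    rw [h2]
  have lie1 : ∀ i j k, i ≠ j → j ≠ k → i ≠ k → Y i j * Y j k - Y j k * Y i j = (m : ℂ) • Y i k := by
    intro i j k hij hjk hik
    have hcg : Commute (ρ (e i j)) (Y i k) := c0 i j i k hij hik hij.symm hik
    have hpow : ∀ t : ℕ, ρ (e i j) ^ t * Y j k = (Y j k + (t : ℂ) • Y i k) * ρ (e i j) ^ t := by
      intro t
      induction t with
      | zero => simp
      | succ t ih =>
        rw [pow_succ', mul_assoc, ih, ← mul_assoc, mul_add, c1 i j k hij hjk hik, mul_smul_comm,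
          hcg.eq, ← smul_mul_assoc, ← add_mul, mul_assoc, ← pow_succ']
        congr 1
        push_cast
        rw [add_smul, one_smul]; abel
    refine IsLog.lie (u := u i j) (hY i j hij) ?_ ?_
    · simp only [hu, map_pow]; exact hpow m
    · simp only [hu, map_pow]
      exact (hcg.symm.smul_left _).pow_right m
  have lie0 : ∀ i j k l, i ≠ j → k ≠ l → j ≠ k → i ≠ l → Commute (Y i j) (Y k l) := by
    intro i j k l hij hkl hjk hil
    refine ((hY i j hij).commute (u := u i j) ?_).symm
    have := ((c0 i j k l hij hkl hjk hil).pow_left m).symm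
    simpa only [hu, map_pow] using this
  have hφY : ∀ i j, i ≠ j → ∀ w, φ (Y i j w) = 0 := by
    intro i j hij
    have hex : ∀ x ∈ Algebra.adjoin ℚ {u i j}, ∃ c : ℂ, ∀ w, φ (x w) = c * φ w := by
      intro x hx
      induction hx using Algebra.adjoin_induction with
      | mem x hx =>
        rw [Set.mem_singleton_iff] at hx; subst hx
        exact ⟨1, fun w => by rw [one_mul]; exact hφ _ w⟩
      | algebraMap r =>
        refine ⟨(r : ℂ), fun w => ?_⟩
        have : algebraMap ℚ (Module.End ℂ W) r = algebraMap ℂ (Module.End ℂ W) (r : ℂ) := rfl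
        rw [this, Module.algebraMap_end_apply, map_smul, smul_eq_mul]
      | add x y _ _ hx hy =>
        obtain ⟨a, ha⟩ := hx
        obtain ⟨b, hb⟩ := hy
        exact ⟨a + b, fun w => by rw [LinearMap.add_apply, map_add, ha, hb, add_mul]⟩
      | mul x y _ _ hx hy =>
        obtain ⟨a, ha⟩ := hx
        obtain ⟨b, hb⟩ := hy
        exact ⟨a * b, fun w => by rw [Module.End.mul_apply, ha, hb, mul_assoc]⟩
    obtain ⟨c, hc⟩ := hex _ (hY i j hij).mem
    obtain ⟨N, hN⟩ := (hY i j hij).nil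
    have hpow : ∀ t : ℕ, ∀ w, φ ((Y i j ^ t) w) = c ^ t * φ w := by
      intro t
      induction t with
      | zero => intro w; simp
      | succ t ih => intro w; rw [pow_succ, Module.End.mul_apply, ih, hc, pow_succ, mul_assoc]
    obtain ⟨w, hw⟩ : ∃ w, φ w ≠ 0 := by
      by_contra! h
      exact hφ0 (LinearMap.ext h)
    have h3 := hpow N w
    rw [hN] at h3
    simp only [LinearMap.zero_apply, map_zero] at h3
    have hc0 : c = 0 := by
      have := (mul_eq_zero.1 h3.symm).resolve_right hw
      by_contra h; exact pow_ne_zero N h this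
    intro w; rw [hc, hc0, zero_mul]
  obtain ⟨w0, hw0, hw0M⟩ := lie_fix hn (fun i j => (m : ℂ)⁻¹ • Y i j) (by
      intro i j k hij hjk hik
      simp only [smul_mul_smul_comm]
      rw [← smul_sub, lie1 i j k hij hjk hik, smul_smul]
      congr 1
      field_simp) (by
      intro i j k l hij hkl hjk hil
      simp only [smul_mul_smul_comm]
      rw [← smul_sub, (lie0 i j k l hij hkl hjk hil).eq, sub_self, smul_zero])
    (fun i j hij => by
      obtain ⟨N, hN⟩ := (hY i j hij).nil
      exact ⟨N, by rw [smul_pow, hN, smul_zero]⟩) φ hφ0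
    (fun i j hij w => by rw [LinearMap.smul_apply, map_smul, hφY i j hij, smul_zero])
  let M : Submodule ℂ W :=
    { carrier := {w | ∀ i j, i ≠ j → Y i j w = 0}
      add_mem' := fun {a b} ha hb i j hij => by rw [map_add, ha i j hij, hb i j hij, add_zero]
      zero_mem' := fun i j _ => map_zero _
      smul_mem' := fun c x hx i j hij => by rw [map_smul, hx i j hij, smul_zero] }
  have hMmem : ∀ w, w ∈ M ↔ ∀ i j, i ≠ j → Y i j w = 0 := fun w => Iff.rfl
  refine ⟨m, hm0, M, ⟨w0, ?_, hw0⟩, ?_, ?_⟩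
  · intro i j hij
    have h := hw0M i j hij
    rw [LinearMap.smul_apply] at h
    exact (smul_eq_zero.1 h).resolve_left (inv_ne_zero hmC)
  · intro k l hkl w hw
    rw [hMmem] at hw ⊢
    have main : ∀ i j, i ≠ j → ¬ (k = j ∧ l = i) → Y i j (ρ (e k l) w) = 0 := by
      intro i j hij hne
      by_cases hli : l = i
      · subst hli
        have hkj : k ≠ j := fun h => hne ⟨h, rfl⟩
        have r1 := congrArg (fun f => f w) (c1 k l j hkl hij hkj)
        have r2 := congrArg (fun f => f w) (c0 k l k j hkl hkj hkl.symm hkj).eq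
        simp only [Module.End.mul_apply, LinearMap.add_apply, hw _ _ hij, hw _ _ hkj, map_zero] at r1 r2
        rw [← r2, zero_add] at r1
        exact r1.symm
      · by_cases hkj : k = j
        · subst hkj
          have r1 := congrArg (fun f => f w) (c2 i k l hij hkl (Ne.symm hli))
          simp only [Module.End.mul_apply, LinearMap.add_apply, hw _ _ hij, hw _ _ (Ne.symm hli),
            map_zero, add_zero] at r1
          exact r1.symm
        · have r2 := congrArg (fun f => f w) (c0 k l i j hkl hij hli hkj).eq
          simp only [Module.End.mul_apply, hw _ _ hij, map_zero] at r2
          exact r2.symm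
    intro i j hij
    by_cases hne : k = j ∧ l = i
    · obtain ⟨rfl, rfl⟩ := hne
      obtain ⟨p, hpl, hpk⟩ := third_index hn l k
      have r := congrArg (fun f => f (ρ (e k l) w)) (lie1 l p k hpl.symm hpk hij)
      simp only [Module.End.mul_apply, LinearMap.sub_apply, LinearMap.smul_apply] at r
      rw [main p k hpk (fun h => hpl h.2.symm), main l p hpl.symm (fun h => hpk h.1.symm)] at r
      simp only [map_zero, sub_zero] at r
      exact (smul_eq_zero.1 r.symm).resolve_left hmC
    · exact main i j hij hne
  · intro i j hij w hw
    have hl := hY i j hij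
    obtain ⟨s, hs, hexp⟩ := exp_form (Y i j) hl.nil
    rw [hl.exp] at hexp
    show u i j w = w
    rw [hexp, hs.eq, ← mul_assoc]
    simp only [LinearMap.add_apply, Module.End.mul_apply, hw i j hij, map_zero, add_zero,
      Module.End.one_apply]
end logpart


section grp
open Matrix

/-- The matrix acting as `A` on the coordinates `i`, `j`. -/
def blkMat {n : ℕ} (i j : Fin n) (A : Matrix (Fin 2) (Fin 2) ℤ) : Matrix (Fin n) (Fin n) ℤ :=
  fun r c => if r = i then (if c = i then A 0 0 else 0) + (if c = j then A 0 1 else 0)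
    else if r = j then (if c = i then A 1 0 else 0) + (if c = j then A 1 1 else 0)
    else if c = r then 1 else 0

theorem blkMat_mulVec {n : ℕ} (i j : Fin n) (A : Matrix (Fin 2) (Fin 2) ℤ) (v : Fin n → ℤ) :
    blkMat i j A *ᵥ v = fun r => if r = i then A 0 0 * v i + A 0 1 * v j
      else if r = j then A 1 0 * v i + A 1 1 * v j else v r := by
  funext r
  simp only [Matrix.mulVec, dotProduct, blkMat]
  split_ifs <;> simp [add_mul, Finset.sum_add_distrib]

theorem mat_ext {n : ℕ} (A B : Matrix (Fin n) (Fin n) ℤ) (h : ∀ v, A *ᵥ v = B *ᵥ v) : A = B := by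
  apply Matrix.toLin'.injective
  exact LinearMap.ext fun v => by simpa using h v

/-- The block embedding as a homomorphism to the matrix monoid. -/
def blkHom {n : ℕ} (i j : Fin n) (hij : i ≠ j) :
    SpecialLinearGroup (Fin 2) ℤ →* Matrix (Fin n) (Fin n) ℤ where
  toFun A := blkMat i j A.1
  map_one' := by
    apply mat_ext; intro v
    rw [blkMat_mulVec]; funext r
    simp only [Matrix.one_mulVec]
    split_ifs with h1 h2 <;> simp_all
  map_mul' A B := by
    show blkMat i j (A.1 * B.1) = _
    apply mat_ext; intro v
    rw [← Matrix.mulVec_mulVec, blkMat_mulVec, blkMat_mulVec, blkMat_mulVec]; funext r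
    simp only [Matrix.mul_apply, Fin.sum_univ_two, if_true,
      if_neg hij.symm]
    split_ifs <;> ring

open Classical in
/-- The block embedding. -/
noncomputable def blk {n : ℕ} (i j : Fin n) : SpecialLinearGroup (Fin 2) ℤ →* GL (Fin n) ℤ :=
  if h : i ≠ j then (blkHom i j h).toHomUnits else 1

theorem blk_mulVec {n : ℕ} {i j : Fin n} (h : i ≠ j) (A : SpecialLinearGroup (Fin 2) ℤ)
    (v : Fin n → ℤ) : (blk i j A).1 *ᵥ v = fun r => if r = i then A 0 0 * v i + A 0 1 * v j
      else if r = j then A 1 0 * v i + A 1 1 * v j else v r := by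
  have : (blk i j A).1 = blkMat i j A.1 := by
    rw [blk, dif_pos h]; rfl
  rw [this, blkMat_mulVec]

theorem gl_ext {n : ℕ} (A B : GL (Fin n) ℤ) (h : ∀ v, A.1 *ᵥ v = B.1 *ᵥ v) : A = B :=
  Units.ext (mat_ext _ _ h)

theorem gl_mul_mulVec {n : ℕ} (A B : GL (Fin n) ℤ) (v : Fin n → ℤ) :
    (A * B).1 *ᵥ v = A.1 *ᵥ (B.1 *ᵥ v) := by
  rw [Units.val_mul, Matrix.mulVec_mulVec]

/-- Elementary matrices. -/
noncomputable def elm {n : ℕ} (i j : Fin n) : GL (Fin n) ℤ := blk i j ModularGroup.T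

theorem elm_zpow_mulVec {n : ℕ} {i j : Fin n} (h : i ≠ j) (t : ℤ) (v : Fin n → ℤ) :
    (elm i j ^ t).1 *ᵥ v = fun r => if r = i then v i + t * v j else v r := by
  rw [elm, ← map_zpow, blk_mulVec h, ModularGroup.coe_T_zpow]
  funext r
  split_ifs with h1 h2 <;> simp_all

theorem elm_mulVec {n : ℕ} {i j : Fin n} (h : i ≠ j) (v : Fin n → ℤ) :
    (elm i j).1 *ᵥ v = fun r => if r = i then v i + v j else v r := by
  have := elm_zpow_mulVec h 1 v
  simpa using this

theorem elm_s1 {n : ℕ} (i j k : Fin n) (hij : i ≠ j) (hjk : j ≠ k) (hik : i ≠ k) :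
    elm i j * elm j k = elm i k * elm j k * elm i j := by
  apply gl_ext; intro v
  simp only [gl_mul_mulVec, elm_mulVec hij, elm_mulVec hjk, elm_mulVec hik]
  funext r
  simp only [if_neg hij, if_neg hij.symm, if_neg hjk, if_neg hjk.symm, if_neg hik, if_neg hik.symm,
    if_true]
  split_ifs <;> simp_all <;> ring

theorem elm_s0 {n : ℕ} (i j k l : Fin n) (hij : i ≠ j) (hkl : k ≠ l) (hjk : j ≠ k) (hil : i ≠ l) :
    Commute (elm i j) (elm k l) := by
  apply gl_ext; intro v
  simp only [gl_mul_mulVec, elm_mulVec hij, elm_mulVec hkl]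
  funext r
  simp only [if_neg hij, if_neg hij.symm, if_neg hjk, if_neg hjk.symm, if_neg hil, if_neg hil.symm,
    if_neg hkl, if_neg hkl.symm, if_true]
  by_cases h1 : r = i <;> by_cases h2 : r = k <;> by_cases h3 : i = k <;> simp_all <;> ring

theorem blk_elm_r {n : ℕ} (i j k : Fin n) (hij : i ≠ j) (hik : i ≠ k) (hjk : j ≠ k)
    (A : SpecialLinearGroup (Fin 2) ℤ) :
    blk i j A * elm i k = elm i k ^ (A 0 0) * elm j k ^ (A 1 0) * blk i j A := by
  apply gl_ext; intro v
  simp only [gl_mul_mulVec, elm_mulVec hik, elm_zpow_mulVec hik, elm_zpow_mulVec hjk, blk_mulVec hij]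
  funext r
  simp only [if_neg hij, if_neg hij.symm, if_neg hjk, if_neg hjk.symm, if_neg hik, if_neg hik.symm,
    if_true]
  split_ifs <;> simp_all <;> ring

theorem blk_elm_r' {n : ℕ} (i j k : Fin n) (hij : i ≠ j) (hik : i ≠ k) (hjk : j ≠ k)
    (A : SpecialLinearGroup (Fin 2) ℤ) :
    blk i j A * elm j k = elm i k ^ (A 0 1) * elm j k ^ (A 1 1) * blk i j A := by
  apply gl_ext; intro v
  simp only [gl_mul_mulVec, elm_mulVec hjk, elm_zpow_mulVec hik, elm_zpow_mulVec hjk, blk_mulVec hij]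
  funext r
  simp only [if_neg hij, if_neg hij.symm, if_neg hjk, if_neg hjk.symm, if_neg hik, if_neg hik.symm,
    if_true]
  split_ifs <;> simp_all <;> ring

theorem blk_elm_l {n : ℕ} (i j k : Fin n) (hij : i ≠ j) (hik : i ≠ k) (hjk : j ≠ k)
    (A : SpecialLinearGroup (Fin 2) ℤ) :
    blk i j A * elm k i = elm k i ^ (A 1 1) * elm k j ^ (- A 0 1) * blk i j A := by
  have hd : A 0 0 * A 1 1 - A 0 1 * A 1 0 = 1 := by
    have := A.det_coe; rw [Matrix.det_fin_two] at this; exact this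
  apply gl_ext; intro v
  simp only [gl_mul_mulVec, elm_mulVec hik.symm, elm_zpow_mulVec hik.symm, elm_zpow_mulVec hjk.symm,
    blk_mulVec hij]
  funext r
  simp only [if_neg hij, if_neg hij.symm, if_neg hjk, if_neg hjk.symm, if_neg hik, if_neg hik.symm,
    if_true]
  by_cases h1 : r = i
  · subst h1; simp [hik]
  by_cases h2 : r = j
  · subst h2; simp [hjk, hij.symm]
  by_cases h3 : r = k
  · subst h3; simp [h1, h2]; linear_combination (- v i) * hd
  simp [h1, h2, h3]

theorem blk_elm_l' {n : ℕ} (i j k : Fin n) (hij : i ≠ j) (hik : i ≠ k) (hjk : j ≠ k)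
    (A : SpecialLinearGroup (Fin 2) ℤ) :
    blk i j A * elm k j = elm k i ^ (- A 1 0) * elm k j ^ (A 0 0) * blk i j A := by
  have hd : A 0 0 * A 1 1 - A 0 1 * A 1 0 = 1 := by
    have := A.det_coe; rw [Matrix.det_fin_two] at this; exact this
  apply gl_ext; intro v
  simp only [gl_mul_mulVec, elm_mulVec hjk.symm, elm_zpow_mulVec hik.symm, elm_zpow_mulVec hjk.symm,
    blk_mulVec hij]
  funext r
  simp only [if_neg hij, if_neg hij.symm, if_neg hjk, if_neg hjk.symm, if_neg hik, if_neg hik.symm,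
    if_true]
  by_cases h1 : r = i
  · subst h1; simp [hik]
  by_cases h2 : r = j
  · subst h2; simp [hjk, hij.symm]
  by_cases h3 : r = k
  · subst h3; simp [h1, h2]; linear_combination (- v j) * hd
  simp [h1, h2, h3]

theorem blk_elm_comm {n : ℕ} (i j k l : Fin n) (hij : i ≠ j) (hik : i ≠ k) (hjk : j ≠ k)
    (hil : i ≠ l) (hjl : j ≠ l) (hkl : k ≠ l)
    (A : SpecialLinearGroup (Fin 2) ℤ) : Commute (blk i j A) (elm k l) := by
  apply gl_ext; intro v
  simp only [gl_mul_mulVec, elm_mulVec hkl, blk_mulVec hij]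
  funext r
  simp only [if_neg hil.symm, if_neg hjl.symm, if_neg hjk, if_neg hjk.symm, if_neg hik,
    if_neg hik.symm]
  split_ifs <;> simp_all

/-- Diagonal matrices. -/
noncomputable def dg {n : ℕ} : (Fin n → ℤ)ˣ →* GL (Fin n) ℤ :=
  Units.map (Matrix.diagonalRingHom (Fin n) ℤ).toMonoidHom

theorem dg_mulVec {n : ℕ} (d : (Fin n → ℤ)ˣ) (v : Fin n → ℤ) :
    (dg d).1 *ᵥ v = fun r => d.1 r * v r := by
  have : (dg d).1 = Matrix.diagonal d.1 := rfl
  rw [this]; funext r; rw [Matrix.mulVec_diagonal]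

theorem dg_unit_sq {n : ℕ} (d : (Fin n → ℤ)ˣ) (i : Fin n) : d.1 i * d.1 i = 1 := by
  have h : IsUnit (d.1 i) := (d.isUnit).map (Pi.evalMonoidHom (fun _ => ℤ) i)
  rcases Int.isUnit_iff.1 h with h | h <;> rw [h] <;> norm_num

theorem elm_dg {n : ℕ} (i j : Fin n) (hij : i ≠ j) (d : (Fin n → ℤ)ˣ) :
    elm i j * dg d = dg d * elm i j ^ (d.1 i * d.1 j) := by
  apply gl_ext; intro v
  simp only [gl_mul_mulVec, elm_mulVec hij, elm_zpow_mulVec hij, dg_mulVec]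
  funext r
  have h := dg_unit_sq d i
  by_cases h1 : r = i
  · subst h1; simp only [if_true]; linear_combination (- d.1 j * v j) * h
  · simp [h1]

/-- The elementary subgroup. -/
def Esub (n : ℕ) : Subgroup (GL (Fin n) ℤ) :=
  Subgroup.closure {g | ∃ i j, i ≠ j ∧ g = elm i j}

theorem elm_mem {n : ℕ} (i j : Fin n) (hij : i ≠ j) : elm i j ∈ Esub n :=
  Subgroup.subset_closure ⟨i, j, hij, rfl⟩

theorem blk_mem {n : ℕ} (i j : Fin n) (hij : i ≠ j) (A : SpecialLinearGroup (Fin 2) ℤ) :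
    blk i j A ∈ Esub n := by
  have hT : blk i j ModularGroup.T ∈ Esub n := elm_mem i j hij
  have hS : blk i j ModularGroup.S ∈ Esub n := by
    have : blk i j ModularGroup.S = (elm i j)⁻¹ * elm j i * (elm i j)⁻¹ := by
      rw [eq_mul_inv_iff_mul_eq, eq_inv_mul_iff_mul_eq]
      apply gl_ext; intro v
      simp only [gl_mul_mulVec, elm_mulVec hij, elm_mulVec hij.symm, blk_mulVec hij,
        ModularGroup.coe_S]
      funext r
      split_ifs <;> simp_all [add_comm]
    rw [this]
    exact mul_mem (mul_mem (inv_mem (elm_mem i j hij)) (elm_mem j i hij.symm))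
      (inv_mem (elm_mem i j hij))
  have : (⊤ : Subgroup (SpecialLinearGroup (Fin 2) ℤ)) ≤ (Esub n).comap (blk i j) := by
    rw [← SpecialLinearGroup.SL2Z_generators, Subgroup.closure_le]
    rintro x (rfl | rfl)
    · exact hS
    · exact hT
  exact this (Subgroup.mem_top A)
end grp
section bg
open Matrix

theorem blk_mul_apply {n : ℕ} {i j : Fin n} (h : i ≠ j) (A : SpecialLinearGroup (Fin 2) ℤ)
    (g : GL (Fin n) ℤ) (r c : Fin n) :
    (blk i j A * g).1 r c = if r = i then A 0 0 * g.1 i c + A 0 1 * g.1 j c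
      else if r = j then A 1 0 * g.1 i c + A 1 1 * g.1 j c else g.1 r c :=
  congrFun (blk_mulVec h A (fun s => g.1 s c)) r

theorem chain_down {α : Type} (F : Set α → Prop) (S : ℕ → Set α) (N : ℕ) (hN : F (S N))
    (h : ∀ k < N, F (S (k + 1)) → F (S k)) : F (S 0) := by
  induction N with
  | zero => exact hN
  | succ N ih => exact ih (h N (by omega) hN) (fun k hk => h k (by omega))

theorem sl2_kill (x y : ℤ) : ∃ A : SpecialLinearGroup (Fin 2) ℤ, A 1 0 * x + A 1 1 * y = 0 := by
  by_cases h : x = 0 ∧ y = 0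
  · exact ⟨1, by simp [h.1, h.2]⟩
  · have hg : 0 < Int.gcd x y := by
      rw [Nat.pos_iff_ne_zero]
      intro h0
      exact h (Int.gcd_eq_zero_iff.1 h0)
    have hc : IsCoprime (x / Int.gcd x y) (y / Int.gcd x y) := by
      rw [Int.isCoprime_iff_gcd_eq_one]
      exact Int.gcd_div_gcd_div_gcd hg
    obtain ⟨A, h0, h1⟩ := hc.symm.neg_left.exists_SL2_row 1
    refine ⟨A, ?_⟩
    rw [h0, h1]
    obtain ⟨a, ha⟩ := Int.gcd_dvd_left x y
    obtain ⟨b, hb⟩ := Int.gcd_dvd_right x y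
    have hg' : (Int.gcd x y : ℤ) ≠ 0 := by exact_mod_cast hg.ne'
    have ha' : x / Int.gcd x y = a := Int.ediv_eq_of_eq_mul_right hg' ha
    have hb' : y / Int.gcd x y = b := Int.ediv_eq_of_eq_mul_right hg' hb
    rw [ha', hb']
    linear_combination (-b) * ha + a * hb

theorem upper_unit {n : ℕ} (g : GL (Fin n) ℤ) (hg : ∀ i j : Fin n, j < i → g.1 i j = 0)
    (k : Fin n) : IsUnit (g.1 k k) := by
  have h1 : g.1.IsUpperTriangular := fun i j h => hg i j h
  have h2 := Matrix.det_of_isUpperTriangular h1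
  have h3 : IsUnit g.1.det := (Matrix.isUnit_iff_isUnit_det _).1 g.isUnit
  rw [h2] at h3
  exact isUnit_of_dvd_unit (Finset.dvd_prod_of_mem (fun i => g.1 i i) (Finset.mem_univ k)) h3

theorem diag_mem {n : ℕ} (g : GL (Fin n) ℤ) (hg : ∀ i j : Fin n, i ≠ j → g.1 i j = 0) :
    g ∈ Set.range (dg (n := n)) := by
  have hu : ∀ k, IsUnit (g.1 k k) := upper_unit g (fun i j h => hg i j h.ne')
  have hu' : IsUnit (fun k => g.1 k k) := Pi.isUnit_iff.2 hu
  obtain ⟨d, hd⟩ := hu'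
  refine ⟨d, Units.ext ?_⟩
  show Matrix.diagonal d.1 = g.1
  rw [hd]
  ext i j
  by_cases hij : i = j
  · subst hij; simp
  · rw [Matrix.diagonal_apply_ne _ hij, hg i j hij]

theorem bounded_gen {n : ℕ} (F : Set (GL (Fin n) ℤ) → Prop)
    (mono : ∀ S T, S ⊆ T → F T → F S) (hd : F (Set.range dg))
    (step : ∀ i j, i ≠ j → ∀ S, F S → F {g | ∃ A, blk i j A * g ∈ S}) : F Set.univ := by
  -- phase 2: upper triangular matrices
  have hUp : F {g | ∀ i j : Fin n, j < i → g.1 i j = 0} := by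
    set U : ℕ → Set (GL (Fin n) ℤ) := fun k => {g | (∀ i j : Fin n, j < i → g.1 i j = 0) ∧
      ∀ i j : Fin n, i < j → (j : ℕ) < k → g.1 i j = 0} with hU
    have h0 : F (U 0) := by
      apply chain_down F U n
      · refine mono _ _ ?_ hd
        rintro g ⟨h1, h2⟩
        apply diag_mem
        intro i j hij
        rcases lt_or_gt_of_ne hij with h | h
        · exact h2 i j h j.2
        · exact h1 i j h
      · intro k hk hF
        set κ : Fin n := ⟨k, hk⟩ with hκ
        set P : ℕ → Set (GL (Fin n) ℤ) := fun l => {g | g ∈ U k ∧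
          ∀ i : Fin n, i < κ → (i : ℕ) < l → g.1 i κ = 0} with hP
        have hP0 : F (P 0) := by
          apply chain_down F P n
          · refine mono _ _ ?_ hF
            rintro g ⟨⟨h1, h2⟩, h3⟩
            refine ⟨h1, fun i j hij hj => ?_⟩
            rcases Nat.lt_succ_iff_lt_or_eq.1 hj with h | h
            · exact h2 i j hij h
            · have : j = κ := Fin.ext h
              subst this
              exact h3 i hij i.2
          · intro l hl hF2
            by_cases hlk : k ≤ l
            · refine mono _ _ ?_ hF2
              rintro g ⟨h1, h2⟩
              exact ⟨h1, fun i hi _ => h2 i hi (lt_of_lt_of_le hi hlk)⟩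
            · set lam : Fin n := ⟨l, hl⟩ with hlam
              have hlt : lam < κ := by rw [Fin.lt_def]; simp only [hlam, hκ]; omega
              refine mono _ _ ?_ (step lam κ hlt.ne _ hF2)
              rintro g ⟨⟨h1, h2⟩, h3⟩
              have hsq : g.1 κ κ * g.1 κ κ = 1 := by
                rcases Int.isUnit_iff.1 (upper_unit g h1 κ) with h | h <;> rw [h] <;> norm_num
              refine ⟨ModularGroup.T ^ (- g.1 lam κ * g.1 κ κ), ⟨?_, ?_⟩, ?_⟩
              · intro i j hij
                rw [blk_mul_apply hlt.ne, ModularGroup.coe_T_zpow]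
                split_ifs with e1 e2
                · subst e1
                  simp [h1 _ j hij, h1 κ j (hij.trans hlt)]
                · subst e2
                  simp [h1 _ j hij]
                · exact h1 i j hij
              · intro i j hij hj
                rw [blk_mul_apply hlt.ne, ModularGroup.coe_T_zpow]
                split_ifs with e1 e2
                · subst e1
                  simp [h2 _ j hij hj, h1 κ j hj]
                · subst e2
                  simp [h2 _ j hij hj]
                · exact h2 i j hij hj
              · intro i hi hil
                rw [blk_mul_apply hlt.ne, ModularGroup.coe_T_zpow]
                split_ifs with e1 e2
                · simp; linear_combination (- g.1 lam κ) * hsq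
                · exact absurd e2 hi.ne
                · refine h3 i hi ?_
                  rcases Nat.lt_succ_iff_lt_or_eq.1 hil with h | h
                  · exact h
                  · exact absurd (Fin.ext h) e1
        refine mono _ _ ?_ hP0
        intro g hg
        exact ⟨hg, fun i _ h => absurd h (Nat.not_lt_zero _)⟩
    refine mono _ _ ?_ h0
    intro g hg
    exact ⟨hg, fun i j _ h => absurd h (Nat.not_lt_zero _)⟩
  -- phase 1
  set L : ℕ → Set (GL (Fin n) ℤ) := fun k => {g | ∀ i j : Fin n, j < i → (j : ℕ) < k → g.1 i j = 0}
    with hL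
  have h0 : F (L 0) := by
    apply chain_down F L n
    · refine mono _ _ ?_ hUp
      intro g hg i j hij
      exact hg i j hij j.2
    · intro k hk hF
      set κ : Fin n := ⟨k, hk⟩ with hκ
      set P : ℕ → Set (GL (Fin n) ℤ) := fun l => {g | g ∈ L k ∧
        ∀ i : Fin n, κ < i → (i : ℕ) < l → g.1 i κ = 0} with hP
      have hP0 : F (P 0) := by
        apply chain_down F P n
        · refine mono _ _ ?_ hF
          rintro g ⟨h2, h3⟩
          intro i j hij hj
          rcases Nat.lt_succ_iff_lt_or_eq.1 hj with h | h
          · exact h2 i j hij h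
          · have : j = κ := Fin.ext h
            subst this
            exact h3 i hij i.2
        · intro l hl hF2
          by_cases hlk : l ≤ k
          · refine mono _ _ ?_ hF2
            rintro g ⟨h1, h2⟩
            refine ⟨h1, fun i hi hil => ?_⟩
            have : k < (i : ℕ) := hi
            omega
          · set lam : Fin n := ⟨l, hl⟩ with hlam
            have hlt : κ < lam := by rw [Fin.lt_def]; simp only [hlam, hκ]; omega
            refine mono _ _ ?_ (step κ lam hlt.ne _ hF2)
            rintro g ⟨h2, h3⟩
            obtain ⟨A, hA⟩ := sl2_kill (g.1 κ κ) (g.1 lam κ)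
            refine ⟨A, ?_, ?_⟩
            · intro i j hij hj
              have hjκ : j < κ := hj
              rw [blk_mul_apply hlt.ne]
              split_ifs with e1 e2
              · simp [h2 κ j hjκ hj, h2 lam j (hjκ.trans hlt) hj]
              · simp [h2 κ j hjκ hj, h2 lam j (hjκ.trans hlt) hj]
              · exact h2 i j hij hj
            · intro i hi hil
              rw [blk_mul_apply hlt.ne]
              split_ifs with e1 e2
              · exact absurd e1 hi.ne'
              · exact hA
              · refine h3 i hi ?_
                rcases Nat.lt_succ_iff_lt_or_eq.1 hil with h | h
                · exact h
                · exact absurd (Fin.ext h) e2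
      refine mono _ _ ?_ hP0
      intro g hg
      exact ⟨hg, fun i _ h => absurd h (Nat.not_lt_zero _)⟩
  refine mono _ _ ?_ h0
  intro g _ i j _ h
  exact absurd h (Nat.not_lt_zero _)
end bg

section finq
open scoped commutatorElement
open Matrix

theorem E_diag {n : ℕ} (g : GL (Fin n) ℤ) : ∃ x ∈ Esub n, ∃ d, g = x * dg d := by
  have := bounded_gen (n := n) (fun S => ∀ g ∈ S, ∃ x ∈ Esub n, ∃ d, g = x * dg d)
    (fun S T hST hT g hg => hT g (hST hg))
    (by
      rintro g ⟨d, rfl⟩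
      exact ⟨1, one_mem _, d, by rw [one_mul]⟩)
    (by
      rintro i j hij S hS g ⟨A, hA⟩
      obtain ⟨x, hx, d, hd⟩ := hS _ hA
      refine ⟨(blk i j A)⁻¹ * x, mul_mem (inv_mem (blk_mem i j hij A)) hx, d, ?_⟩
      rw [mul_assoc, ← hd, inv_mul_cancel_left])
  exact this g (Set.mem_univ g)

theorem finite_of_perfect_center {Q : Type} [Group Q] [Finite (Q ⧸ Subgroup.center Q)]
    (hperf : commutator Q = ⊤) : Finite Q := by
  have : Finite (commutatorSet Q) := by
    have hsub : commutatorSet Q ⊆ Set.range (fun p : (Q ⧸ Subgroup.center Q) × (Q ⧸ Subgroup.center Q) =>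
        ⁅p.1.out, p.2.out⁆) := by
      rintro _ ⟨a, b, rfl⟩
      refine ⟨(QuotientGroup.mk a, QuotientGroup.mk b), ?_⟩
      obtain ⟨⟨x, hx⟩, h1⟩ := QuotientGroup.mk_out_eq_mul (Subgroup.center Q) a
      obtain ⟨⟨y, hy⟩, h2⟩ := QuotientGroup.mk_out_eq_mul (Subgroup.center Q) b
      simp only at h1 h2
      simp only [h1, h2, commutatorElement_def, _root_.mul_inv_rev]
      have hx1 : ∀ z, x * z = z * x := fun z => (Subgroup.mem_center_iff.1 hx z).symm
      have hy1 : ∀ z, y * z = z * y := fun z => (Subgroup.mem_center_iff.1 hy z).symm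
      calc a * x * (b * y) * (x⁻¹ * a⁻¹) * (y⁻¹ * b⁻¹)
          = a * (x * (b * y)) * x⁻¹ * a⁻¹ * (y⁻¹ * b⁻¹) := by group
        _ = a * b * (y * (a⁻¹)) * y⁻¹ * b⁻¹ := by rw [hx1]; group
        _ = a * b * a⁻¹ * b⁻¹ := by rw [hy1]; group
    exact (Set.finite_range _).subset hsub
  have h2 : Finite (commutator Q) := inferInstance
  rw [hperf] at h2
  exact Finite.of_equiv _ Subgroup.topEquiv.toEquiv

theorem fin_Q {n : ℕ} (hn : 3 ≤ n) {Q : Type} [Group Q] (f : Esub n →* Q)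
    (hf : Function.Surjective f) (m : ℕ) (hm : 0 < m)
    (hfm : ∀ i j (h : i ≠ j), f ⟨elm i j, elm_mem i j h⟩ ^ m = 1) : Finite Q := by
  haveI : NeZero m := ⟨hm.ne'⟩
  have hpow : ∀ i j (h : i ≠ j) (t s : ℤ), (t : ZMod m) = (s : ZMod m) →
      f ⟨elm i j, elm_mem i j h⟩ ^ t = f ⟨elm i j, elm_mem i j h⟩ ^ s := by
    intro i j h t s hts
    obtain ⟨c, hc⟩ := (ZMod.intCast_eq_intCast_iff_dvd_sub t s m).1 hts
    have : s = t + m * c := by rw [← hc]; ring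
    rw [this, _root_.zpow_add, _root_.zpow_mul, zpow_natCast, hfm i j h, _root_.one_zpow, mul_one]
  -- commuting with generators suffices
  have hcent : ∀ z : Q, (∀ i j (h : i ≠ j), Commute z (f ⟨elm i j, elm_mem i j h⟩)) →
      z ∈ Subgroup.center Q := by
    intro z hz
    rw [Subgroup.mem_center_iff]
    intro y
    obtain ⟨⟨x, hx⟩, rfl⟩ := hf y
    have : ∀ (x : GL (Fin n) ℤ) (hx : x ∈ Esub n), Commute z (f ⟨x, hx⟩) := by
      intro x hx
      induction hx using Subgroup.closure_induction with
      | mem x hx =>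
        obtain ⟨i, j, h, rfl⟩ := hx
        exact hz i j h
      | one => exact (map_one f) ▸ Commute.one_right z
      | mul x y hx hy h1 h2 =>
        have : f ⟨x * y, mul_mem hx hy⟩ = f ⟨x, hx⟩ * f ⟨y, hy⟩ := by rw [← map_mul]; rfl
        exact this ▸ h1.mul_right h2
      | inv x hx h1 =>
        have : f ⟨x⁻¹, inv_mem hx⟩ = (f ⟨x, hx⟩)⁻¹ := by rw [← map_inv]; rfl
        exact this ▸ h1.inv_right
    exact (this x hx).eq.symm
  have hcomm : ∀ i j k (hij : i ≠ j) (hjk : j ≠ k) (hik : i ≠ k),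
      f ⟨elm i j, elm_mem i j hij⟩ * f ⟨elm j k, elm_mem j k hjk⟩ =
      f ⟨elm i k, elm_mem i k hik⟩ * f ⟨elm j k, elm_mem j k hjk⟩ * f ⟨elm i j, elm_mem i j hij⟩ := by
    intro i j k hij hjk hik
    rw [← map_mul, ← map_mul, ← map_mul]
    exact congrArg f (Subtype.ext (elm_s1 i j k hij hjk hik))
  have hcomm' : ∀ i j k (hij : i ≠ j) (hjk : j ≠ k) (hik : i ≠ k),
      f ⟨elm i k, elm_mem i k hik⟩ =
      ⁅f ⟨elm i j, elm_mem i j hij⟩, f ⟨elm j k, elm_mem j k hjk⟩⁆ := by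
    intro i j k hij hjk hik
    rw [commutatorElement_def, hcomm i j k hij hjk hik]; group
  have hperf : commutator Q = ⊤ := by
    rw [eq_top_iff]
    intro y _
    obtain ⟨⟨x, hx⟩, rfl⟩ := hf y
    induction hx using Subgroup.closure_induction with
    | mem x hx =>
      obtain ⟨i, j, h, rfl⟩ := hx
      obtain ⟨p, hpi, hpj⟩ := third_index hn i j
      rw [hcomm' i p j hpi.symm hpj h]
      exact Subgroup.commutator_mem_commutator (Subgroup.mem_top _) (Subgroup.mem_top _)
    | one => exact (map_one f).symm ▸ one_mem (commutator Q)
    | mul x y hx hy h1 h2 =>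
      have : f ⟨x * y, mul_mem hx hy⟩ = f ⟨x, hx⟩ * f ⟨y, hy⟩ := by rw [← map_mul]; rfl
      exact this ▸ mul_mem (h1 trivial) (h2 trivial)
    | inv x hx h1 =>
      have : f ⟨x⁻¹, inv_mem hx⟩ = (f ⟨x, hx⟩)⁻¹ := by rw [← map_inv]; rfl
      exact this ▸ inv_mem (h1 trivial)
  -- congruence block elements are central
  have hblk : ∀ i j (hij : i ≠ j) (A : SpecialLinearGroup (Fin 2) ℤ),
      A ∈ (SpecialLinearGroup.map (n := Fin 2) (Int.castRingHom (ZMod m))).ker →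
      f ⟨blk i j A, blk_mem i j hij A⟩ ∈ Subgroup.center Q := by
    intro i j hij A hA
    rw [MonoidHom.mem_ker] at hA
    have ent : ∀ a b, ((A a b : ℤ) : ZMod m) = (1 : Matrix (Fin 2) (Fin 2) (ZMod m)) a b := by
      intro a b
      have := congrArg (fun B : SpecialLinearGroup (Fin 2) (ZMod m) => B a b) hA
      simpa using this
    have a00 : ((A 0 0 : ℤ) : ZMod m) = ((1 : ℤ) : ZMod m) := by rw [ent]; simp
    have a01 : ((A 0 1 : ℤ) : ZMod m) = ((0 : ℤ) : ZMod m) := by rw [ent]; simp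
    have a10 : ((A 1 0 : ℤ) : ZMod m) = ((0 : ℤ) : ZMod m) := by rw [ent]; simp
    have a11 : ((A 1 1 : ℤ) : ZMod m) = ((1 : ℤ) : ZMod m) := by rw [ent]; simp
    have a01n : ((- A 0 1 : ℤ) : ZMod m) = ((0 : ℤ) : ZMod m) := by
      rw [Int.cast_neg, a01]; simp
    have a10n : ((- A 1 0 : ℤ) : ZMod m) = ((0 : ℤ) : ZMod m) := by
      rw [Int.cast_neg, a10]; simp
    set z := f ⟨blk i j A, blk_mem i j hij A⟩ with hz
    have push : ∀ k l k' l' p q (h0 : p ≠ q) (h : k ≠ l) (h' : k' ≠ l') (s t : ℤ),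
        blk i j A * elm p q = elm k l ^ s * elm k' l' ^ t * blk i j A →
        z * f ⟨elm p q, elm_mem p q h0⟩ =
          f ⟨elm k l, elm_mem k l h⟩ ^ s * f ⟨elm k' l', elm_mem k' l' h'⟩ ^ t * z := by
      intro k l k' l' p q h0 h h' s t heq
      rw [hz, ← map_zpow, ← map_zpow, ← map_mul, ← map_mul, ← map_mul]
      exact congrArg f (Subtype.ext heq)
    have q1 : ∀ k (hik : i ≠ k) (_ : j ≠ k), Commute z (f ⟨elm i k, elm_mem i k hik⟩) := by
      intro k hik hjk
      have := push i k j k i k hik hik hjk _ _ (blk_elm_r i j k hij hik hjk A)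
      rw [hpow i k hik _ _ a00, hpow j k hjk _ _ a10, zpow_one, zpow_zero, mul_one] at this
      exact this
    have q2 : ∀ k (_ : i ≠ k) (hjk : j ≠ k), Commute z (f ⟨elm j k, elm_mem j k hjk⟩) := by
      intro k hik hjk
      have := push i k j k j k hjk hik hjk _ _ (blk_elm_r' i j k hij hik hjk A)
      rw [hpow i k hik _ _ a01, hpow j k hjk _ _ a11, zpow_one, zpow_zero, one_mul] at this
      exact this
    have q3 : ∀ k (hki : k ≠ i) (_ : k ≠ j), Commute z (f ⟨elm k i, elm_mem k i hki⟩) := by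
      intro k hki hkj
      have := push k i k j k i hki hki hkj _ _ (blk_elm_l i j k hij hki.symm hkj.symm A)
      rw [hpow k i hki _ _ a11, hpow k j hkj _ _ a01n, zpow_one, zpow_zero, mul_one] at this
      exact this
    have q4 : ∀ k (_ : k ≠ i) (hkj : k ≠ j), Commute z (f ⟨elm k j, elm_mem k j hkj⟩) := by
      intro k hki hkj
      have := push k i k j k j hkj hki hkj _ _ (blk_elm_l' i j k hij hki.symm hkj.symm A)
      rw [hpow k i hki _ _ a10n, hpow k j hkj _ _ a00, zpow_one, zpow_zero, one_mul] at this
      exact this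
    have q5 : ∀ k l (_ : k ≠ i) (_ : k ≠ j) (_ : l ≠ i) (_ : l ≠ j) (hkl : k ≠ l),
        Commute z (f ⟨elm k l, elm_mem k l hkl⟩) := by
      intro k l hki hkj hli hlj hkl
      show _ * _ = _ * _
      rw [hz, ← map_mul, ← map_mul]
      exact congrArg f (Subtype.ext
        (blk_elm_comm i j k l hij hki.symm hkj.symm hli.symm hlj.symm hkl A).eq)
    have hbr : ∀ a b : Q, Commute z a → Commute z b → Commute z ⁅a, b⁆ := by
      intro a b ha hb
      rw [commutatorElement_def]
      exact ((ha.mul_right hb).mul_right ha.inv_right).mul_right hb.inv_right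
    obtain ⟨p, hpi, hpj⟩ := third_index hn i j
    apply hcent
    intro k l hkl
    by_cases hki : k = i
    · subst hki
      by_cases hlj : l = j
      · subst hlj
        rw [hcomm' k p l hpi.symm hpj hkl]
        exact hbr _ _ (q1 p hpi.symm hpj.symm) (q4 p hpi hpj)
      · exact q1 l hkl (Ne.symm hlj)
    by_cases hkj : k = j
    · subst hkj
      by_cases hli : l = i
      · subst hli
        rw [hcomm' k p l hpj.symm hpi hkl]
        exact hbr _ _ (q2 p hpi.symm hpj.symm) (q3 p hpi hpj)
      · exact q2 l (Ne.symm hli) hkl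
    by_cases hli : l = i
    · subst hli; exact q3 k hki hkj
    by_cases hlj : l = j
    · subst hlj; exact q4 k hki hkj
    exact q5 k l hki hkj hli hlj hkl
  -- finite image in the central quotient
  let Z := Q ⧸ Subgroup.center Q
  let pr : Q →* Z := QuotientGroup.mk' _
  have hfinblk : ∀ i j (hij : i ≠ j), (Set.range fun A => pr (f ⟨blk i j A, blk_mem i j hij A⟩)).Finite := by
    intro i j hij
    let ψ : SpecialLinearGroup (Fin 2) ℤ →* Z :=
      (pr.comp f).comp ((blk i j).codRestrict (Esub n) (blk_mem i j hij))
    set π := SpecialLinearGroup.map (n := Fin 2) (Int.castRingHom (ZMod m)) with hπ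
    have hker : π.ker ≤ ψ.ker := by
      intro A hA
      rw [MonoidHom.mem_ker]
      exact (QuotientGroup.eq_one_iff _).2 (hblk i j hij A hA)
    have hfac : ∀ A B, π A = π B → ψ A = ψ B := by
      intro A B hAB
      have h1 : A⁻¹ * B ∈ π.ker := by
        rw [MonoidHom.mem_ker, map_mul, map_inv, hAB, inv_mul_cancel]
      have h2 := hker h1
      rw [MonoidHom.mem_ker, map_mul, map_inv, inv_mul_eq_one] at h2
      exact h2
    haveI : Finite (SpecialLinearGroup (Fin 2) (ZMod m)) := Subtype.finite
    have hsub : (Set.range fun A => ψ A) ⊆ Set.range (fun b => ψ (Function.invFun π b)) := by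
      rintro _ ⟨A, rfl⟩
      exact ⟨π A, hfac _ _ (Function.invFun_eq ⟨A, rfl⟩)⟩
    exact (Set.finite_range _).subset hsub
  have hfin := bounded_gen (n := n) (fun S => {q : Z | ∃ x : Esub n, x.1 ∈ S ∧ pr (f x) = q}.Finite)
    (fun S T hST hT => hT.subset (by rintro q ⟨x, hx, rfl⟩; exact ⟨x, hST hx, rfl⟩))
    (by
      haveI : Finite ((Fin n → ℤ)ˣ) := Finite.of_equiv _ (MulEquiv.piUnits (M := fun _ : Fin n => ℤ)).symm.toEquiv
      have h1 : (Set.range (dg (n := n))).Finite := Set.finite_range _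
      have h2 : {x : Esub n | x.1 ∈ Set.range (dg (n := n))}.Finite :=
        h1.preimage Subtype.val_injective.injOn
      exact (h2.image (fun x => pr (f x))).subset (by rintro q ⟨x, hx, rfl⟩; exact ⟨x, hx, rfl⟩))
    (by
      intro i j hij S hS
      refine (Set.Finite.image2 (fun a b => a⁻¹ * b) (hfinblk i j hij) hS).subset ?_
      rintro q ⟨x, ⟨A, hA⟩, rfl⟩
      refine ⟨pr (f ⟨blk i j A, blk_mem i j hij A⟩), ⟨A, rfl⟩,
        pr (f (⟨blk i j A, blk_mem i j hij A⟩ * x)), ⟨_, hA, rfl⟩, ?_⟩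
      simp only [map_mul, inv_mul_cancel_left])
  haveI : Finite (Q ⧸ Subgroup.center Q) := by
    have : (Set.univ : Set Z).Finite := hfin.subset (by
      intro q _
      obtain ⟨y, rfl⟩ := QuotientGroup.mk_surjective q
      obtain ⟨x, rfl⟩ := hf y
      exact ⟨x, Set.mem_univ _, rfl⟩)
    exact Set.finite_univ_iff.1 this
  exact finite_of_perfect_center hperf
end finq

section maininv

theorem main_inv (n : ℕ) (hn : 3 ≤ n) (W : Type) [AddCommGroup W] [Module ℂ W]
    [FiniteDimensional ℂ W] (ρ : GL (Fin n) ℤ →* Module.End ℂ W) (φ : W →ₗ[ℂ] ℂ)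
    (hφ : ∀ g w, φ (ρ g w) = φ w) (hφ0 : φ ≠ 0) : ∃ w, (∀ g, ρ g w = w) ∧ φ w ≠ 0 := by
  obtain ⟨m, hm, M, ⟨w0, hw0M, hw0⟩, hMinv, hMfix⟩ := log_fix hn elm elm_s1 elm_s0 ρ φ hφ hφ0
  have hpw : ∀ i j, i ≠ j → ∀ t : ℕ, ∀ w ∈ M, ρ (elm i j ^ t) w ∈ M := by
    intro i j hij t
    induction t with
    | zero => intro w hw; simpa using hw
    | succ t ih =>
      intro w hw
      rw [pow_succ, map_mul, Module.End.mul_apply]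
      exact ih _ (hMinv i j hij w hw)
  have hE2 : ∀ x ∈ Esub n, (∀ w ∈ M, ρ x w ∈ M) ∧ (∀ w ∈ M, ρ x⁻¹ w ∈ M) := by
    intro x hx
    induction hx using Subgroup.closure_induction with
    | mem x hx =>
      obtain ⟨i, j, h, rfl⟩ := hx
      refine ⟨hMinv i j h, fun w hw => ?_⟩
      obtain ⟨t, rfl⟩ := Nat.exists_eq_succ_of_ne_zero hm.ne'
      have h1 := hMfix i j h w hw
      rw [← h1, ← Module.End.mul_apply, ← map_mul, Nat.succ_eq_add_one, pow_succ',
        inv_mul_cancel_left]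
      exact hpw i j h t w hw
    | one => exact ⟨fun w hw => by simpa using hw, fun w hw => by simpa using hw⟩
    | mul x y _ _ hx hy =>
      refine ⟨fun w hw => ?_, fun w hw => ?_⟩
      · rw [map_mul, Module.End.mul_apply]; exact hx.1 _ (hy.1 _ hw)
      · rw [mul_inv_rev, map_mul, Module.End.mul_apply]; exact hy.2 _ (hx.2 _ hw)
    | inv x _ hx => exact ⟨hx.2, by rw [inv_inv]; exact hx.1⟩
  let f0 : Esub n →* Module.End ℂ M :=
    { toFun := fun x => (ρ x.1).restrict (hE2 x.1 x.2).1
      map_one' := by ext w; simp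
      map_mul' := fun x y => by ext w; simp }
  have hf0 : ∀ (x : Esub n) (w : M), ((f0 x w : M) : W) = ρ x.1 w := fun x w => rfl
  let f : Esub n →* (Module.End ℂ M)ˣ := f0.toHomUnits
  have hfin : Finite f.range := by
    refine fin_Q hn f.rangeRestrict f.rangeRestrict_surjective m hm ?_
    intro i j h
    rw [← map_pow]
    apply Subtype.ext
    apply Units.ext
    apply LinearMap.ext
    intro w
    apply Subtype.ext
    exact hMfix i j h w w.2
  have : Fintype f.range := Fintype.ofFinite _
  set w1 : M := ∑ q : f.range, (q.1.1 : Module.End ℂ M) ⟨w0, hw0M⟩ with hw1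
  have hinv1 : ∀ x : Esub n, f0 x w1 = w1 := by
    intro x
    rw [hw1, map_sum]
    refine Fintype.sum_equiv (Equiv.mulLeft (f.rangeRestrict x)) _ _ ?_
    intro q
    rfl
  have hφ1 : φ w1 ≠ 0 := by
    have h1 : ∀ q : f.range, φ ((q.1.1 : Module.End ℂ M) ⟨w0, hw0M⟩ : M) = φ w0 := by
      rintro ⟨_, x, rfl⟩
      exact hφ x.1 w0
    rw [hw1, Submodule.coe_sum, map_sum, Finset.sum_congr rfl (fun q _ => h1 q), Finset.sum_const,
      nsmul_eq_mul]
    refine mul_ne_zero ?_ hw0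
    have : (Finset.univ : Finset f.range).card ≠ 0 := by
      rw [Finset.card_univ]; exact Fintype.card_ne_zero
    exact_mod_cast this
  have hinvE : ∀ x ∈ Esub n, ρ x w1 = w1 := fun x hx => by
    rw [← hf0 ⟨x, hx⟩ w1, hinv1]
  have hfD : Finite ((Fin n → ℤ)ˣ) :=
    Finite.of_equiv _ (MulEquiv.piUnits (M := fun _ : Fin n => ℤ)).symm.toEquiv
  have : Fintype ((Fin n → ℤ)ˣ) := Fintype.ofFinite _
  set w2 : W := ∑ d : (Fin n → ℤ)ˣ, ρ (dg d) w1 with hw2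
  have hD2 : ∀ d, ρ (dg d) w2 = w2 := by
    intro d
    rw [hw2, map_sum]
    refine Fintype.sum_equiv (Equiv.mulLeft d) _ _ ?_
    intro c
    rw [Equiv.coe_mulLeft, map_mul, map_mul, Module.End.mul_apply]
  have hgen2 : ∀ i j, i ≠ j → ρ (elm i j) w2 = w2 := by
    intro i j hij
    rw [hw2, map_sum]
    refine Finset.sum_congr rfl fun d _ => ?_
    rw [← Module.End.mul_apply, ← map_mul, elm_dg i j hij, map_mul, Module.End.mul_apply,
      hinvE _ (zpow_mem (elm_mem i j hij) _)]
  have hE3 : ∀ x ∈ Esub n, ρ x w2 = w2 := by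
    intro x hx
    induction hx using Subgroup.closure_induction with
    | mem x hx =>
      obtain ⟨i, j, h, rfl⟩ := hx
      exact hgen2 i j h
    | one => simp
    | mul x y _ _ hx hy => rw [map_mul, Module.End.mul_apply, hy, hx]
    | inv x _ hx =>
      conv_lhs => rw [← hx]
      rw [← Module.End.mul_apply, ← map_mul, inv_mul_cancel, map_one, Module.End.one_apply]
  refine ⟨w2, fun g => ?_, ?_⟩
  · obtain ⟨x, hx, d, rfl⟩ := E_diag g
    rw [map_mul, Module.End.mul_apply, hD2, hE3 x hx]
  · rw [hw2, map_sum, Finset.sum_congr rfl (fun d _ => hφ (dg d) w1), Finset.sum_const,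
      nsmul_eq_mul]
    refine mul_ne_zero ?_ hφ1
    have : (Finset.univ : Finset ((Fin n → ℤ)ˣ)).card ≠ 0 := by
      rw [Finset.card_univ]; exact Fintype.card_ne_zero
    exact_mod_cast this
end maininv

open TensorProduct

theorem descend {G : Type} [Group G]
    (H : ∀ (W : Type) [AddCommGroup W] [Module ℂ W]
    [FiniteDimensional ℂ W] (ρ : G →* Module.End ℂ W) (φ : W →ₗ[ℂ] ℂ)
    (_ : ∀ g w, φ (ρ g w) = φ w) (_ : φ ≠ 0), ∃ w, (∀ g, ρ g w = w) ∧ φ w ≠ 0)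
    {W : Type} [AddCommGroup W] [Module ℚ W] [FiniteDimensional ℚ W]
    (σ : G →* Module.End ℚ W) (φ : W →ₗ[ℚ] ℚ)
    (hφ : ∀ g w, φ (σ g w) = φ w) (hφ0 : φ ≠ 0) : ∃ w, (∀ g, σ g w = w) ∧ φ w = 1 := by
  let ρ : G →* Module.End ℂ (ℂ ⊗[ℚ] W) :=
    { toFun := fun g => (σ g).baseChange ℂ
      map_one' := by ext; simp
      map_mul' := fun a b => by ext; simp }
  let ψ : (ℂ ⊗[ℚ] W) →ₗ[ℂ] ℂ := (TensorProduct.AlgebraTensorModule.rid ℚ ℂ ℂ).toLinearMap ∘ₗ φ.baseChange ℂ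
  have hψt : ∀ c w, ψ (c ⊗ₜ w) = φ w • c := fun c w => by simp [ψ]
  obtain ⟨w, hw, hw0⟩ := H (ℂ ⊗[ℚ] W) ρ ψ (by
      intro g w
      induction w with
      | zero => simp
      | add x y hx hy => simp only [map_add, hx, hy]
      | tmul c v => simp [ρ, hψt, hφ]) (by
      obtain ⟨v, hv⟩ : ∃ v, φ v ≠ 0 := by
        by_contra h; push Not at h; exact hφ0 (LinearMap.ext h)
      intro h
      have := hψt 1 v
      rw [h] at this
      simp at this
      exact hv (by exact_mod_cast this.symm))
  obtain ⟨r, hr⟩ : ∃ r : ℂ →ₗ[ℚ] ℚ, r (ψ w) = 1 := by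
    obtain ⟨f, hf⟩ := Module.Projective.exists_dual_ne_zero ℚ hw0
    exact ⟨(f (ψ w))⁻¹ • f, by simp [hf]⟩
  let R : ℂ ⊗[ℚ] W →ₗ[ℚ] W := (TensorProduct.lid ℚ W).toLinearMap ∘ₗ r.rTensor W
  have hRt : ∀ c w, R (c ⊗ₜ w) = r c • w := fun c w => by simp [R]
  have h1 : ∀ g x, R (ρ g x) = σ g (R x) := by
    intro g x
    induction x with
    | zero => simp
    | add x y hx hy => simp only [map_add, hx, hy]
    | tmul c v => simp [ρ, hRt]
  have h2 : ∀ x, φ (R x) = r (ψ x) := by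
    intro x
    induction x with
    | zero => simp
    | add x y hx hy => simp only [map_add, hx, hy]
    | tmul c v => simp [hψt, hRt, mul_comm]
  exact ⟨R w, fun g => by rw [← h1, hw], by rw [h2, hr]⟩

theorem cocycle_ext {G V : Type} [Group G] [AddCommGroup V] [Module ℚ V] [FiniteDimensional ℚ V]
    (H : ∀ (W : Type) [AddCommGroup W] [Module ℂ W]
    [FiniteDimensional ℂ W] (ρ : G →* Module.End ℂ W) (φ : W →ₗ[ℂ] ℂ)
    (_ : ∀ g w, φ (ρ g w) = φ w) (_ : φ ≠ 0), ∃ w, (∀ g, ρ g w = w) ∧ φ w ≠ 0)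
    (σ : G →* Module.End ℚ V) (c : G → V) (hc : ∀ g h, c (g * h) = σ g (c h) + c g) :
    ∃ v, ∀ g, σ g v - v = c g := by
  have hc1 : c 1 = 0 := by simpa using hc 1 1
  let τ : G →* Module.End ℚ (V × ℚ) :=
    { toFun := fun g => LinearMap.prod ((σ g) ∘ₗ LinearMap.fst ℚ V ℚ +
          (LinearMap.toSpanSingleton ℚ V (c g)) ∘ₗ LinearMap.snd ℚ V ℚ) (LinearMap.snd ℚ V ℚ)
      map_one' := by ext <;> simp [hc1]
      map_mul' := fun a b => by ext <;> simp [hc] }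
  obtain ⟨⟨v, t⟩, hw, h1⟩ := descend H τ (LinearMap.snd ℚ V ℚ) (by intro g w; simp [τ]) (by
    intro h
    have := LinearMap.congr_fun h (0, 1)
    simp at this)
  simp at h1
  subst h1
  refine ⟨-v, fun g => ?_⟩
  have := congrArg Prod.fst (hw g)
  simp [τ] at this
  rw [map_neg, sub_neg_eq_add, neg_add_eq_iff_eq_add, this]

theorem statement_6 (n : ℕ) (hn : 3 ≤ n)
    (V : Rep ℚ (GL (Fin n) ℤ)) [FiniteDimensional ℚ V] :
    ∀ x : groupCohomology V 1, x = 0 := by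
  intro x
  induction x using groupCohomology.H1_induction_on with
  | h f =>
  rw [groupCohomology.H1π_eq_zero_iff]
  obtain ⟨v, hv⟩ := cocycle_ext (main_inv n hn) V.ρ f
    (fun g h => (groupCohomology.mem_cocycles₁_iff (f : _ → V)).1 f.2 g h)
  exact ⟨v, funext fun g => hv g⟩
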